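/- For every integer r ≥ 2 and every d with 0 < d ≤ 2/3 there exist ε₀ > 0 and n₀ such that the following holds for all 0 < ε ≤ ε₀ and n ≥ n₀. Let G be an r-partite graph with parts A₁,…,A_r, each of size n, such that for all i ≠ j the pair G[A_i,A_j] is (d_{i,j}, ε)-super-regular for some d_{i,j} ≥ d. Let 𝓗 be the r-uniform hypergraph whose hyperedges are the vertex sets of the r-partite r-cliques of G (one vertex in each part). Then there exists a weighting ω: 𝓗 → {0,1} such that for every vertex v ∈ A₁ ∪ ⋯ ∪ A_r one has |Σ_{H ∈ 𝓗, H ∋ v} ω(H) − (1/2)·n^{r−1}·∏_{1 ≤ i < j ≤ r} d_{i,j}| ≤ n^{r−4/3}. -/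

import Mathlib

open Finset

variable {V : Type*} [Fintype V] [DecidableEq V]

/-- The number of neighbours of `v` in the set `B`. -/
def nbrCount (G : SimpleGraph V) [DecidableRel G.Adj] (v : V) (B : Finset V) : ℕ :=
  (B.filter (fun w => G.Adj v w)).card

/-- The edge density `d_G(A,B) = e_G(A,B)/(|A||B|)` between the vertex sets `A` and `B`. -/
noncomputable def pairDensity (G : SimpleGraph V) [DecidableRel G.Adj] (A B : Finset V) : ℝ :=
  (∑ v ∈ A, (nbrCount G v B : ℝ)) / ((A.card : ℝ) * (B.card : ℝ))

/-- The pair `(A,B)` is `(d,ε)`-regular in `G`: it has density `d`, and all pairs of subsets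
`X ⊆ A`, `Y ⊆ B` with `|X| ≥ ε|A|`, `|Y| ≥ ε|B|` have density within `ε` of `d`. -/
def IsRegularPair (G : SimpleGraph V) [DecidableRel G.Adj] (A B : Finset V) (d ε : ℝ) : Prop :=
  pairDensity G A B = d ∧
    ∀ X ⊆ A, ∀ Y ⊆ B, ε * A.card ≤ X.card → ε * B.card ≤ Y.card →
      |pairDensity G X Y - d| ≤ ε

/-- The pair `(A,B)` is `(d,ε,δ')`-super-regular in `G`: it is `(d,ε)`-regular and every vertex
of one side has at least `δ'` times the size of the other side many neighbours there. -/
def IsSuperRegular3 (G : SimpleGraph V) [DecidableRel G.Adj] (A B : Finset V)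
    (d ε δ' : ℝ) : Prop :=
  IsRegularPair G A B d ε ∧
    (∀ v ∈ A, δ' * B.card ≤ (nbrCount G v B : ℝ)) ∧
    (∀ v ∈ B, δ' * A.card ≤ (nbrCount G v A : ℝ))

/-- `(d,ε)`-super-regular means `(d,ε,d-ε)`-super-regular. -/
def IsSuperRegular (G : SimpleGraph V) [DecidableRel G.Adj] (A B : Finset V) (d ε : ℝ) : Prop :=
  IsSuperRegular3 G A B d ε (d - ε)

open Classical in
/-- The `r`-partite `r`-cliques of `G` with respect to the parts `A i`: cliques having exactly
one vertex in each part. -/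
noncomputable def transvCliques {V : Type*} [Fintype V] [DecidableEq V] (G : SimpleGraph V)
    {r : ℕ} (A : Fin r → Finset V) : Finset (Finset V) :=
  Finset.univ.filter (fun K : Finset V => G.IsClique ↑K ∧ ∀ i, (K ∩ A i).card = 1)

/-- The pairs `(i, j)` with `i < j`. -/
def ltPairs (r : ℕ) : Finset (Fin r × Fin r) := univ.filter fun p => p.1 < p.2

/-- The pairs `(i, j)` with `i < j` that avoid the index `k`. -/
def ltPairsAvoiding {r : ℕ} (k : Fin r) : Finset (Fin r × Fin r) :=
  (ltPairs r).filter fun p => p.1 ≠ k ∧ p.2 ≠ k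

lemma sum_sum_update {r n : ℕ} (i : Fin r) (F : (Fin r → Fin n) → ℝ) :
    ∑ t, ∑ u, F (Function.update t i u) = n * ∑ t, F t := by
  have e : Function.Involutive (fun q : (Fin r → Fin n) × Fin n =>
      (Function.update q.1 i q.2, q.1 i)) := by
    rintro ⟨t, u⟩
    simp
  calc ∑ t, ∑ u, F (Function.update t i u)
      = ∑ q : (Fin r → Fin n) × Fin n, F (Function.update q.1 i q.2) := by
        rw [Fintype.sum_prod_type]
    _ = ∑ q : (Fin r → Fin n) × Fin n, F q.1 :=
        Fintype.sum_equiv e.toPerm _ _ (fun q => rfl)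
    _ = n * ∑ t, F t := by
        rw [Fintype.sum_prod_type]
        simp [mul_sum]

lemma sum_prod_apply {r n : ℕ} (f : Fin r → Fin n → ℝ) :
    ∑ t : Fin r → Fin n, ∏ j, f j (t j) = ∏ j, ∑ y, f j y := by
  rw [Finset.prod_univ_sum]
  simp

lemma prod_ltPairs_eq {r : ℕ} (k : Fin r) (s : Fin r → Fin r → ℝ) (hs : ∀ i j, s i j = s j i) :
    ∏ p ∈ ltPairs r, s p.1 p.2 =
      (∏ p ∈ ltPairsAvoiding k, s p.1 p.2) * ∏ j ∈ univ.erase k, s k j := by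
  unfold ltPairsAvoiding
  rw [← Finset.prod_filter_mul_prod_filter_not (ltPairs r) (fun p => p.1 ≠ k ∧ p.2 ≠ k)]
  congr 1
  refine Finset.prod_bij' (fun p _ => if p.1 = k then p.2 else p.1)
    (fun j _ => if j < k then (j, k) else (k, j)) ?_ ?_ ?_ ?_ ?_
  · rintro ⟨i, j⟩ h
    simp only [ltPairs, mem_filter, mem_univ, true_and] at h
    by_cases hi : i = k
    · subst hi; simp; exact h.1.ne'
    · simp [hi]
  · intro j h
    simp only [mem_erase, mem_univ, and_true] at h
    by_cases hj : j < k
    · simp [hj, ltPairs]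
    · have : k < j := lt_of_le_of_ne (not_lt.mp hj) (Ne.symm h)
      simp [hj, ltPairs, this]
  · rintro ⟨i, j⟩ h
    simp only [ltPairs, mem_filter, mem_univ, true_and] at h
    by_cases hi : i = k
    · subst hi; simp [not_lt.mpr h.1.le]
    · have hj : j = k := by
        by_contra hj; exact h.2 ⟨hi, hj⟩
      subst hj
      simp [hi, h.1]
  · intro j h
    simp only [mem_erase, mem_univ, and_true] at h
    by_cases hj : j < k
    · simp [hj, h]
    · simp [hj]
  · rintro ⟨i, j⟩ h
    simp only [ltPairs, mem_filter, mem_univ, true_and] at h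
    by_cases hi : i = k
    · subst hi; simp
    · have hj : j = k := by
        by_contra hj; exact h.2 ⟨hi, hj⟩
      subst hj
      simp [hi, hs i j]

/-- `a` is the family of bipartite adjacency matrices of an `r`-partite graph with parts of size
`n`, the pair `(i, j)` having density `D i j ≥ d`, cut-norm discrepancy at most `ε`, and minimum
degree at least `(D i j - ε) n`. -/
structure IsQuasirandom {r n : ℕ} (a : Fin r → Fin r → Fin n → Fin n → ℝ)
    (D : Fin r → Fin r → ℝ) (d ε : ℝ) : Prop where
  zero_one : ∀ i j x y, a i j x y = 0 ∨ a i j x y = 1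
  symm : ∀ i j x y, a i j x y = a j i y x
  dens_symm : ∀ i j, D i j = D j i
  le_dens : ∀ i j, i ≠ j → d ≤ D i j
  dens_le : ∀ i j, i ≠ j → D i j ≤ 1
  cut : ∀ i j, i ≠ j → ∀ X Y : Finset (Fin n),
    |∑ x ∈ X, ∑ y ∈ Y, (a i j x y - D i j)| ≤ ε * n ^ 2
  min_degree : ∀ i j, i ≠ j → ∀ x, (D i j - ε) * n ≤ ∑ y, a i j x y

/-- With all coordinates but `i` and `j` fixed, `Φ` is a product of `{0,1}`-valued functions of
coordinate `i` and of coordinate `j`. -/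
def Separates {r n : ℕ} (i j : Fin r) (Φ : (Fin r → Fin n) → ℝ) : Prop :=
  ∀ t, ∃ h k : Fin n → ℝ, (∀ x, h x = 0 ∨ h x = 1) ∧ (∀ x, k x = 0 ∨ k x = 1) ∧
    ∀ u v, Φ (Function.update (Function.update t i u) j v) = h u * k v

lemma Separates.mul {r n : ℕ} {i j : Fin r} {Φ Ψ : (Fin r → Fin n) → ℝ}
    (hΦ : Separates i j Φ) (hΨ : Separates i j Ψ) : Separates i j fun t => Φ t * Ψ t := by
  intro t
  obtain ⟨h, k, hh, hk, e⟩ := hΦ t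
  obtain ⟨h', k', hh', hk', e'⟩ := hΨ t
  refine ⟨fun x => h x * h' x, fun x => k x * k' x, fun x => ?_, fun x => ?_, fun u v => ?_⟩
  · rcases hh x with h1 | h1 <;> rcases hh' x with h2 | h2 <;> simp [h1, h2]
  · rcases hk x with h1 | h1 <;> rcases hk' x with h2 | h2 <;> simp [h1, h2]
  · simp only [e, e']; ring

lemma Separates.prod {r n : ℕ} {i j : Fin r} {κ : Type*} (s : Finset κ)
    (Φ : κ → (Fin r → Fin n) → ℝ) (hΦ : ∀ q ∈ s, Separates i j (Φ q)) :
    Separates i j fun t => ∏ q ∈ s, Φ q t := by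
  classical
  induction s using Finset.induction_on with
  | empty => exact fun t => ⟨fun _ => 1, fun _ => 1, by simp, by simp, by simp⟩
  | insert q s hq ih =>
    simp only [prod_insert hq]
    exact (hΦ q (mem_insert_self _ _)).mul (ih fun q' h => hΦ q' (mem_insert_of_mem h))

lemma separates_apply {r n : ℕ} {i j : Fin r} (hij : i ≠ j) (l : Fin r) (f : Fin n → ℝ)
    (hf : ∀ x, f x = 0 ∨ f x = 1) : Separates i j fun t => f (t l) := by
  intro t
  by_cases hl : l = j
  · subst hl
    exact ⟨fun _ => 1, f, by simp, hf, by simp⟩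
  · exact ⟨fun u => f (Function.update t i u l), fun _ => 1, fun x => hf _, by simp,
      by simp [Function.update_of_ne hl]⟩

lemma separates_apply₂ {r n : ℕ} {i j : Fin r} (hij : i ≠ j) (l m : Fin r)
    (f : Fin n → Fin n → ℝ) (hf : ∀ x y, f x y = 0 ∨ f x y = 1)
    (hlm : (l ≠ i ∧ m ≠ i) ∨ (l ≠ j ∧ m ≠ j)) : Separates i j fun t => f (t l) (t m) := by
  intro t
  rcases hlm with ⟨hl, hm⟩ | ⟨hl, hm⟩
  · refine ⟨fun _ => 1, fun v => f (Function.update t j v l) (Function.update t j v m),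
      by simp, fun x => hf _ _, fun u v => ?_⟩
    rw [Function.update_comm hij]
    simp [Function.update_of_ne hl, Function.update_of_ne hm]
  · exact ⟨fun u => f (Function.update t i u l) (Function.update t i u m), fun _ => 1,
      fun x => hf _ _, by simp, by simp [Function.update_of_ne hl, Function.update_of_ne hm]⟩

lemma abs_sum_mul_le_of_cut {n : ℕ} {M : Fin n → Fin n → ℝ} {c : ℝ}
    (hM : ∀ X Y : Finset (Fin n), |∑ x ∈ X, ∑ y ∈ Y, M x y| ≤ c) {h k : Fin n → ℝ}
    (hh : ∀ x, h x = 0 ∨ h x = 1) (hk : ∀ x, k x = 0 ∨ k x = 1) :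
    |∑ x, ∑ y, M x y * (h x * k y)| ≤ c := by
  convert hM (univ.filter fun x => h x = 1) (univ.filter fun y => k y = 1) using 2
  rw [sum_filter]
  refine sum_congr rfl fun x _ => ?_
  rcases hh x with hx | hx
  · simp [hx]
  · simp only [hx, one_mul, if_true, sum_filter]
    refine sum_congr rfl fun y _ => ?_
    rcases hk y with hy | hy <;> simp [hy]

lemma IsQuasirandom.abs_sum_sub_mul_le {r n : ℕ} {a : Fin r → Fin r → Fin n → Fin n → ℝ}
    {D : Fin r → Fin r → ℝ} {d ε : ℝ} (H : IsQuasirandom a D d ε) (hn : 0 < n)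
    {i j : Fin r} (hij : i ≠ j) {Φ : (Fin r → Fin n) → ℝ} (hΦ : Separates i j Φ) :
    |∑ t, (a i j (t i) (t j) - D i j) * Φ t| ≤ ε * n ^ r := by
  have hn' : (0 : ℝ) < n := by exact_mod_cast hn
  set F : (Fin r → Fin n) → ℝ := fun t => (a i j (t i) (t j) - D i j) * Φ t with hF
  have key : (n : ℝ) ^ 2 * ∑ t, F t =
      ∑ t, ∑ u, ∑ v, F (Function.update (Function.update t i u) j v) := by
    have h1 := sum_sum_update j F
    have h2 := sum_sum_update i fun t => ∑ v, F (Function.update t j v)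
    rw [h2, h1]; ring
  have hb : ∀ t, |∑ u, ∑ v, F (Function.update (Function.update t i u) j v)| ≤ ε * n ^ 2 := by
    intro t
    obtain ⟨h, k, hh, hk, e⟩ := hΦ t
    have := abs_sum_mul_le_of_cut (H.cut i j hij) hh hk
    simpa [hF, e, Function.update_of_ne hij] using this
  have h3 : (n : ℝ) ^ 2 * |∑ t, F t| ≤ n ^ 2 * (ε * n ^ r) := by
    calc (n : ℝ) ^ 2 * |∑ t, F t| = |(n : ℝ) ^ 2 * ∑ t, F t| := by
          rw [abs_mul, abs_of_nonneg (by positivity : (0 : ℝ) ≤ (n : ℝ) ^ 2)]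
      _ ≤ ∑ t : Fin r → Fin n, ε * n ^ 2 := by
          rw [key]
          exact (abs_sum_le_sum_abs _ _).trans (sum_le_sum fun t _ => hb t)
      _ = n ^ 2 * (ε * n ^ r) := by
          simp; ring
  exact le_of_mul_le_mul_left h3 (by positivity)

lemma IsQuasirandom.counting {r n : ℕ} {a : Fin r → Fin r → Fin n → Fin n → ℝ}
    {D : Fin r → Fin r → ℝ} {d ε : ℝ} (H : IsQuasirandom a D d ε) (hn : 0 < n) (hd : 0 ≤ d)
    (f : Fin r → Fin n → ℝ) (hf : ∀ i x, f i x = 0 ∨ f i x = 1)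
    (E : Finset (Fin r × Fin r)) (hE : E ⊆ ltPairs r) :
    |∑ t : Fin r → Fin n, (∏ j, f j (t j)) * ∏ p ∈ E, a p.1 p.2 (t p.1) (t p.2) -
      (∏ p ∈ E, D p.1 p.2) * ∏ j, ∑ y, f j y| ≤ #E * ε * n ^ r := by
  induction E using Finset.induction_on with
  | empty => simp [sum_prod_apply]
  | insert p E hp ih =>
    have ih := ih fun q hq => hE (mem_insert_of_mem hq)
    have hlt : p.1 < p.2 := by simpa [ltPairs] using hE (mem_insert_self p E)
    have hsep : Separates p.1 p.2 fun t : Fin r → Fin n =>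
        (∏ j, f j (t j)) * ∏ q ∈ E, a q.1 q.2 (t q.1) (t q.2) := by
      refine Separates.mul ?_ ?_
      · exact Separates.prod _ (fun j t => f j (t j)) fun j _ =>
          separates_apply hlt.ne j _ (hf j)
      · refine Separates.prod _ (fun (q : Fin r × Fin r) t => a q.1 q.2 (t q.1) (t q.2)) fun q hq =>
          separates_apply₂ hlt.ne _ _ _ (H.zero_one _ _) ?_
        have hq' : q.1 < q.2 := by simpa [ltPairs] using hE (mem_insert_of_mem hq)
        have hne : q ≠ p := fun h => hp (h ▸ hq)
        by_contra hcon
        apply hne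
        ext <;> grind
    have h1 := H.abs_sum_sub_mul_le hn hlt.ne hsep
    have hD0 : 0 ≤ D p.1 p.2 := hd.trans (H.le_dens _ _ hlt.ne)
    have hD1 : D p.1 p.2 ≤ 1 := H.dens_le _ _ hlt.ne
    set S := ∑ t : Fin r → Fin n, (∏ j, f j (t j)) * ∏ p ∈ E, a p.1 p.2 (t p.1) (t p.2)
    rw [prod_insert hp, card_insert_of_notMem hp]
    have e : ∑ t : Fin r → Fin n, (∏ j, f j (t j)) *
        ∏ q ∈ insert p E, a q.1 q.2 (t q.1) (t q.2) =
        (∑ t : Fin r → Fin n, (a p.1 p.2 (t p.1) (t p.2) - D p.1 p.2) *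
          ((∏ j, f j (t j)) * ∏ q ∈ E, a q.1 q.2 (t q.1) (t q.2))) + D p.1 p.2 * S := by
      rw [mul_sum, ← sum_add_distrib]
      refine sum_congr rfl fun t _ => ?_
      rw [prod_insert hp]; ring
    rw [e]
    set B := ∑ t : Fin r → Fin n, (a p.1 p.2 (t p.1) (t p.2) - D p.1 p.2) *
          ((∏ j, f j (t j)) * ∏ q ∈ E, a q.1 q.2 (t q.1) (t q.2))
    calc _ = |B + D p.1 p.2 * (S - (∏ p ∈ E, D p.1 p.2) * ∏ j, ∑ y, f j y)| := by
          congr 1; ring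
      _ ≤ |B| + D p.1 p.2 * |S - (∏ p ∈ E, D p.1 p.2) * ∏ j, ∑ y, f j y| := by
          refine (abs_add_le _ _).trans ?_
          rw [abs_mul, abs_of_nonneg hD0]
      _ ≤ ε * n ^ r + 1 * (#E * ε * n ^ r) := by
          gcongr
      _ = _ := by push_cast; ring

lemma prod_sub_card_mul_le {κ : Type*} [DecidableEq κ] (s : Finset κ) (D : κ → ℝ) {ε : ℝ}
    (hε : 0 ≤ ε) (h0 : ∀ j ∈ s, ε ≤ D j) (h1 : ∀ j ∈ s, D j ≤ 1) :
    ∏ j ∈ s, D j - #s * ε ≤ ∏ j ∈ s, (D j - ε) := by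
  induction s using Finset.induction_on with
  | empty => simp
  | insert q s hq ih =>
    have ih := ih (fun j h => h0 j (mem_insert_of_mem h)) (fun j h => h1 j (mem_insert_of_mem h))
    have hq0 := h0 q (mem_insert_self _ _)
    have hq1 := h1 q (mem_insert_self _ _)
    rw [prod_insert hq, prod_insert hq, card_insert_of_notMem hq]
    have hP1 : ∏ j ∈ s, (D j - ε) ≤ 1 := prod_le_one
      (fun j h => by linarith [h0 j (mem_insert_of_mem h)])
      (fun j h => by linarith [h1 j (mem_insert_of_mem h)])
    have hP0 : 0 ≤ ∏ j ∈ s, (D j - ε) := prod_nonneg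
      (fun j h => by linarith [h0 j (mem_insert_of_mem h)])
    have hc : (0 : ℝ) ≤ #s * ε := by positivity
    push_cast
    nlinarith [mul_le_mul_of_nonneg_left ih (hε.trans hq0), mul_le_mul_of_nonneg_left hP1 hε,
      mul_le_mul_of_nonneg_right hq1 hc]

lemma one_sub_prod_le_sum {κ : Type*} [DecidableEq κ] (s : Finset κ) (g : κ → ℝ)
    (h0 : ∀ j ∈ s, 0 ≤ g j) (h1 : ∀ j ∈ s, g j ≤ 1) :
    1 - ∏ j ∈ s, g j ≤ ∑ j ∈ s, (1 - g j) := by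
  induction s using Finset.induction_on with
  | empty => simp
  | insert q s hq ih =>
    have ih := ih (fun j h => h0 j (mem_insert_of_mem h)) (fun j h => h1 j (mem_insert_of_mem h))
    have hq0 := h0 q (mem_insert_self _ _)
    have hq1 := h1 q (mem_insert_self _ _)
    have hP1 : ∏ j ∈ s, g j ≤ 1 := prod_le_one
      (fun j h => h0 j (mem_insert_of_mem h)) (fun j h => h1 j (mem_insert_of_mem h))
    rw [prod_insert hq, sum_insert hq]
    nlinarith

/-- The indicator of the tuples `t` whose entries are pairwise adjacent. -/
def cliqueInd {r n : ℕ} (a : Fin r → Fin r → Fin n → Fin n → ℝ) (t : Fin r → Fin n) : ℝ :=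
  ∏ p ∈ ltPairs r, a p.1 p.2 (t p.1) (t p.2)

lemma card_ltPairs_le (r : ℕ) : (#(ltPairs r) : ℝ) ≤ r * r := by
  have : #(ltPairs r) ≤ r * r := by
    simpa using card_le_univ (ltPairs r)
  exact_mod_cast this

lemma card_ltPairsAvoiding_le {r : ℕ} (k : Fin r) : (#(ltPairsAvoiding k) : ℝ) ≤ r * r := by
  refine le_trans ?_ (card_ltPairs_le r)
  exact_mod_cast card_filter_le _ _

section
variable {r n : ℕ} {a : Fin r → Fin r → Fin n → Fin n → ℝ} {D : Fin r → Fin r → ℝ} {d ε : ℝ}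

lemma IsQuasirandom.cliqueInd_update (H : IsQuasirandom a D d ε) (t : Fin r → Fin n) (i : Fin r)
    (x : Fin n) : cliqueInd a (Function.update t i x) =
      (∏ p ∈ ltPairsAvoiding i, a p.1 p.2 (t p.1) (t p.2)) *
        ∏ j ∈ univ.erase i, a i j x (t j) := by
  unfold cliqueInd
  rw [prod_ltPairs_eq i (fun l m => a l m (Function.update t i x l) (Function.update t i x m))
    fun l m => H.symm _ _ _ _]
  congr 1
  · refine prod_congr rfl fun p hp => ?_
    have hp := (mem_filter.mp hp).2
    simp [Function.update_of_ne hp.1, Function.update_of_ne hp.2]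
  · refine prod_congr rfl fun j hj => ?_
    simp [Function.update_of_ne (ne_of_mem_erase hj)]

lemma IsQuasirandom.cliqueInd_zero_one (H : IsQuasirandom a D d ε) (t : Fin r → Fin n) :
    cliqueInd a t = 0 ∨ cliqueInd a t = 1 := by
  by_cases h : ∀ p ∈ ltPairs r, a p.1 p.2 (t p.1) (t p.2) = 1
  · exact Or.inr (prod_eq_one h)
  · push Not at h
    obtain ⟨p, hp, hne⟩ := h
    exact Or.inl (prod_eq_zero hp ((H.zero_one _ _ _ _).resolve_right hne))

lemma IsQuasirandom.cliqueInd_nonneg (H : IsQuasirandom a D d ε) (t : Fin r → Fin n) :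
    0 ≤ cliqueInd a t := by
  rcases H.cliqueInd_zero_one t with h | h <;> simp [h]

lemma IsQuasirandom.cliqueInd_le_one (H : IsQuasirandom a D d ε) (t : Fin r → Fin n) :
    cliqueInd a t ≤ 1 := by
  rcases H.cliqueInd_zero_one t with h | h <;> simp [h]

lemma IsQuasirandom.pow_le_prod (H : IsQuasirandom a D d ε) (hd0 : 0 < d) (hd1 : d ≤ 1)
    {E : Finset (Fin r × Fin r)} (hE : E ⊆ ltPairs r) :
    d ^ (r * r) ≤ ∏ p ∈ E, D p.1 p.2 := by
  have hcard : #E ≤ r * r := by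
    simpa using card_le_univ E
  calc d ^ (r * r) ≤ d ^ #E := pow_le_pow_of_le_one hd0.le hd1 hcard
    _ = ∏ p ∈ E, d := by simp
    _ ≤ _ := prod_le_prod (fun _ _ => hd0.le) fun p hp => H.le_dens _ _ (by
        have : p.1 < p.2 := by simpa [ltPairs] using hE hp
        exact this.ne)

lemma IsQuasirandom.prod_le_one (H : IsQuasirandom a D d ε) (hd0 : 0 < d)
    {E : Finset (Fin r × Fin r)} (hE : E ⊆ ltPairs r) :
    ∏ p ∈ E, D p.1 p.2 ≤ 1 := by
  have hlt : ∀ p ∈ E, p.1 ≠ p.2 := fun p hp => by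
    have : p.1 < p.2 := by simpa [ltPairs] using hE hp
    exact this.ne
  exact Finset.prod_le_one (fun p hp => hd0.le.trans (H.le_dens _ _ (hlt p hp)))
    fun p hp => H.dens_le _ _ (hlt p hp)

lemma IsQuasirandom.sum_cliqueInd_le (H : IsQuasirandom a D d ε) (hn : 0 < n) (hd : 0 ≤ d)
    (hε : 0 ≤ ε) :
    ∑ t, cliqueInd a t ≤ (∏ p ∈ ltPairs r, D p.1 p.2 + r * r * ε) * n ^ r := by
  have h := H.counting hn hd (fun _ _ => 1) (by simp) (ltPairs r) subset_rfl
  have h2 := (abs_le.mp h).2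
  simp only [prod_const_one, one_mul, sum_const, card_univ, Fintype.card_fin, nsmul_eq_mul,
    mul_one, prod_const] at h2
  have h3 : (#(ltPairs r) : ℝ) * ε * n ^ r ≤ r * r * ε * n ^ r := by
    gcongr; exact card_ltPairs_le r
  unfold cliqueInd
  linarith

/-- Tuples `t` all of whose entries but the `i`-th form a clique in the sets with indicators
`f j`. -/
lemma IsQuasirandom.le_sum_avoiding (H : IsQuasirandom a D d ε) (hn : 0 < n) (hd : 0 ≤ d)
    (hε : 0 ≤ ε) (i : Fin r) (f : Fin r → Fin n → ℝ) (hf : ∀ j x, f j x = 0 ∨ f j x = 1) :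
    (∏ p ∈ ltPairsAvoiding i, D p.1 p.2) * (n * ∏ j ∈ univ.erase i, ∑ y, f j y) -
        r * r * ε * n ^ r ≤
      ∑ t : Fin r → Fin n, (∏ p ∈ ltPairsAvoiding i, a p.1 p.2 (t p.1) (t p.2)) *
        ∏ j ∈ univ.erase i, f j (t j) := by
  have h := H.counting hn hd (fun j x => if j = i then 1 else f j x)
    (by intro j x; by_cases hj : j = i <;> simp [hj, hf]) (ltPairsAvoiding i) (filter_subset _ _)
  have h2 := (abs_le.mp h).1
  have h3 : (#(ltPairsAvoiding i) : ℝ) * ε * n ^ r ≤ r * r * ε * n ^ r := by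
    gcongr; exact card_ltPairsAvoiding_le i
  have e1 : ∀ t : Fin r → Fin n, ∏ j, (if j = i then 1 else f j (t j)) =
      ∏ j ∈ univ.erase i, f j (t j) := by
    intro t
    rw [← mul_prod_erase univ _ (mem_univ i)]
    simp only [if_true, one_mul]
    exact prod_congr rfl fun j hj => by simp [ne_of_mem_erase hj]
  have e2 : ∏ j, ∑ y : Fin n, (if j = i then 1 else f j y) =
      n * ∏ j ∈ univ.erase i, ∑ y, f j y := by
    rw [← mul_prod_erase univ _ (mem_univ i)]
    simp only [if_true, sum_const, card_univ, Fintype.card_fin, nsmul_eq_mul, mul_one]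
    congr 1
    exact prod_congr rfl fun j hj => by simp [ne_of_mem_erase hj]
  simp only [e1, e2] at h2
  simp only [mul_comm (∏ p ∈ ltPairsAvoiding i, a p.1 p.2 _ _)]
  linarith

lemma IsQuasirandom.le_degree (H : IsQuasirandom a D d ε) (hn : 0 < n) (hd : 0 < d)
    (hε : 0 ≤ ε) (hεd : ε ≤ d) (i : Fin r) (x : Fin n) :
    (∏ p ∈ ltPairs r, D p.1 p.2 - (r * r + r) * ε) * n ^ r ≤
      ∑ t, cliqueInd a (Function.update t i x) := by
  have h := H.le_sum_avoiding hn hd.le hε i (fun j y => a i j x y) (fun j y => H.zero_one _ _ _ _)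
  simp only [← H.cliqueInd_update] at h
  rw [prod_ltPairs_eq i D H.dens_symm]
  have hr : 0 < r := i.pos
  have hcard : #(univ.erase i) = r - 1 := by simp
  have hne : ∀ j ∈ univ.erase i, i ≠ j := fun j hj => (ne_of_mem_erase hj).symm
  have h1 : ∏ j ∈ univ.erase i, ((D i j - ε) * n) ≤ ∏ j ∈ univ.erase i, ∑ y, a i j x y :=
    prod_le_prod (fun j hj => mul_nonneg (by linarith [H.le_dens i j (hne j hj)]) (by positivity))
      fun j hj => H.min_degree i j (hne j hj) x
  rw [prod_mul_distrib, prod_const, hcard] at h1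
  have h2 := prod_sub_card_mul_le (univ.erase i) (D i) hε
    (fun j hj => hεd.trans (H.le_dens i j (hne j hj))) (fun j hj => H.dens_le i j (hne j hj))
  have h3 : (#(univ.erase i) : ℝ) * ε ≤ r * ε := by
    gcongr
    rw [hcard]; omega
  set Q := ∏ p ∈ ltPairsAvoiding i, D p.1 p.2 with hQ
  have hQ1 : Q ≤ 1 := H.prod_le_one hd (filter_subset _ _)
  have hQ0 : 0 ≤ Q := prod_nonneg fun p hp => by
    have : p.1 < p.2 := by simpa [ltPairs] using (mem_filter.mp hp).1
    exact hd.le.trans (H.le_dens _ _ this.ne)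
  have hpow : (n : ℝ) ^ r = n * n ^ (r - 1) := by
    rw [← pow_succ', Nat.sub_add_cancel hr]
  have h4 : (∏ j ∈ univ.erase i, D i j - r * ε) * n ^ (r - 1) ≤
      ∏ j ∈ univ.erase i, ∑ y, a i j x y := by
    refine le_trans ?_ h1
    gcongr
    linarith
  have h5 := mul_le_mul_of_nonneg_left (mul_le_mul_of_nonneg_left h4 (Nat.cast_nonneg (α := ℝ) n))
    hQ0
  have h6 : Q * (r * ε * n ^ r) ≤ 1 * (r * ε * n ^ r) := by gcongr
  rw [hpow] at h6 h ⊢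
  nlinarith
end

lemma card_mul_sum_apply {r n : ℕ} (i : Fin r) (φ : Fin n → ℝ) :
    n * ∑ t : Fin r → Fin n, φ (t i) = n ^ r * ∑ u, φ u := by
  rw [← sum_sum_update i fun t => φ (t i)]
  simp

lemma exists_almost_regular_weight {r n : ℕ} {a : Fin r → Fin r → Fin n → Fin n → ℝ}
    {D : Fin r → Fin r → ℝ} {d ε : ℝ} (H : IsQuasirandom a D d ε) (hn : 0 < n) (hd : 0 < d)
    (hε : 0 ≤ ε) (hεd : ε ≤ d) {P δ : ℝ} (hP : P = ∏ p ∈ ltPairs r, D p.1 p.2)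
    (hP0 : 0 < P) (hδ : δ = (r * r + r) * ε) (hδP : δ < P) :
    ∃ w : (Fin r → Fin n) → ℝ, (∀ t, w t ≤ cliqueInd a t) ∧ (∀ t, P ^ r * cliqueInd a t ≤ w t) ∧
      (∀ i x, ∑ t, w (Function.update t i x) ≤ P * n ^ r) ∧
      ∀ i x, (P - (δ + r * (2 * δ / P))) * n ^ r ≤ ∑ t, w (Function.update t i x) := by
  have hn' : (0 : ℝ) < n := by exact_mod_cast hn
  have hnr : (0 : ℝ) < (n : ℝ) ^ r := by positivity
  have hP1 : P ≤ 1 := hP ▸ H.prod_le_one hd subset_rfl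
  have hδ0 : 0 ≤ δ := by rw [hδ]; positivity
  set c : ℝ := P * n ^ r with hc
  have hc0 : 0 < c := by positivity
  set deg : Fin r → Fin n → ℝ := fun i x => ∑ t, cliqueInd a (Function.update t i x) with hdeg
  have hdl : ∀ i x, c - δ * n ^ r ≤ deg i x := fun i x => by
    have := H.le_degree hn hd hε hεd i x
    rw [← hP, ← hδ] at this
    rw [hc, ← sub_mul]; exact this
  have hd0 : ∀ i x, 0 < deg i x := fun i x => by
    refine lt_of_lt_of_le ?_ (hdl i x)
    rw [hc, ← sub_mul]
    exact mul_pos (by linarith) hnr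
  have hdu : ∀ i x, deg i x ≤ n ^ r := fun i x => by
    calc deg i x ≤ ∑ t : Fin r → Fin n, (1 : ℝ) := sum_le_sum fun t _ => H.cliqueInd_le_one _
      _ = n ^ r := by simp
  have hds : ∀ i, ∑ x, (deg i x - c + δ * n ^ r) ≤ n * (2 * δ * n ^ r) := fun i => by
    have h1 : ∑ x, deg i x = n * ∑ t, cliqueInd a t := by
      rw [hdeg, sum_comm, sum_sum_update]
    have h2 := H.sum_cliqueInd_le hn hd.le hε
    rw [← hP] at h2
    have h3 : (r * r : ℝ) * ε ≤ δ := by rw [hδ]; nlinarith [Nat.cast_nonneg (α := ℝ) r]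
    simp only [sum_add_distrib, sum_sub_distrib, h1, sum_const, card_univ, Fintype.card_fin,
      nsmul_eq_mul]
    have h4 : ∑ t, cliqueInd a t ≤ c + δ * n ^ r := by
      refine h2.trans ?_
      rw [hc, ← add_mul]
      gcongr
    nlinarith
  set g : Fin r → Fin n → ℝ := fun i x => if deg i x ≤ c then 1 else c / deg i x with hg
  have hg0 : ∀ i x, P ≤ g i x := fun i x => by
    simp only [hg]; split_ifs with h
    · exact hP1
    · rw [le_div_iff₀ (hd0 i x)]
      exact mul_le_mul_of_nonneg_left (hdu i x) hP0.le
  have hg1 : ∀ i x, g i x ≤ 1 := fun i x => by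
    simp only [hg]; split_ifs with h
    · exact le_rfl
    · rw [div_le_one (hd0 i x)]; exact (not_le.mp h).le
  have hgu : ∀ i x, g i x * deg i x ≤ c := fun i x => by
    simp only [hg]; split_ifs with h
    · simpa using h
    · rw [div_mul_cancel₀ _ (hd0 i x).ne']
  have hgl : ∀ i x, c - δ * n ^ r ≤ g i x * deg i x := fun i x => by
    simp only [hg]; split_ifs with h
    · simpa using hdl i x
    · rw [div_mul_cancel₀ _ (hd0 i x).ne']
      linarith [mul_nonneg hδ0 hnr.le]
  have hgc : ∀ i x, (1 - g i x) * c ≤ deg i x - c + δ * n ^ r := fun i x => by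
    simp only [hg]; split_ifs with h
    · simpa using by linarith [hdl i x]
    · have h' := not_le.mp h
      have : (1 - c / deg i x) * c ≤ (1 - c / deg i x) * deg i x := by
        refine mul_le_mul_of_nonneg_left h'.le ?_
        rw [sub_nonneg, div_le_one (hd0 i x)]; exact h'.le
      rw [sub_mul (1 : ℝ) _ (deg i x), div_mul_cancel₀ _ (hd0 i x).ne'] at this
      linarith [mul_nonneg hδ0 hnr.le]
  have hgs : ∀ i, ∑ t : Fin r → Fin n, (1 - g i (t i)) ≤ 2 * δ / P * n ^ r := fun i => by
    have h1 := card_mul_sum_apply i fun x => 1 - g i x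
    have h2 : (∑ x, (1 - g i x)) * c ≤ n * (2 * δ * n ^ r) := by
      rw [sum_mul]
      exact (sum_le_sum fun x _ => hgc i x).trans (hds i)
    have h3 : (∑ x, (1 - g i x)) * P ≤ n * (2 * δ) := by
      refine le_of_mul_le_mul_right ?_ hnr
      calc _ = (∑ x, (1 - g i x)) * c := by rw [hc]; ring
        _ ≤ _ := h2
        _ = _ := by ring
    refine le_of_mul_le_mul_left ?_ hn'
    rw [h1]
    rw [← le_div_iff₀ hP0] at h3
    calc (n : ℝ) ^ r * ∑ x, (1 - g i x) ≤ n ^ r * (n * (2 * δ) / P) := by gcongr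
      _ = _ := by ring
  have hgn : ∀ i x, 0 ≤ g i x := fun i x => hP0.le.trans (hg0 i x)
  have hupd : ∀ i x (t : Fin r → Fin n), ∏ j, g j (Function.update t i x j) =
      g i x * ∏ j ∈ univ.erase i, g j (t j) := fun i x t => by
    rw [← mul_prod_erase univ _ (mem_univ i)]
    simp only [Function.update_self]
    congr 1
    exact prod_congr rfl fun j hj => by rw [Function.update_of_ne (ne_of_mem_erase hj)]
  refine ⟨fun t => cliqueInd a t * ∏ j, g j (t j), fun t => ?_, fun t => ?_, fun i x => ?_,
    fun i x => ?_⟩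
  · exact mul_le_of_le_one_right (H.cliqueInd_nonneg t)
      (prod_le_one (fun j _ => hgn _ _) fun j _ => hg1 _ _)
  · rw [mul_comm]
    refine mul_le_mul_of_nonneg_left ?_ (H.cliqueInd_nonneg t)
    calc P ^ r = ∏ j : Fin r, P := by simp
      _ ≤ _ := prod_le_prod (fun _ _ => hP0.le) fun j _ => hg0 _ _
  · refine le_trans ?_ (hgu i x)
    simp only [hdeg, hupd]
    rw [mul_sum]
    refine sum_le_sum fun t _ => ?_
    rw [mul_comm]
    refine mul_le_mul_of_nonneg_right ?_ (H.cliqueInd_nonneg _)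
    exact mul_le_of_le_one_right (hgn _ _) (prod_le_one (fun j _ => hgn _ _) fun j _ => hg1 _ _)
  · simp only [hupd]
    have h1 : ∀ t : Fin r → Fin n,
        g i x * cliqueInd a (Function.update t i x) - ∑ j, (1 - g j (t j)) ≤
        cliqueInd a (Function.update t i x) * (g i x * ∏ j ∈ univ.erase i, g j (t j)) := by
      intro t
      have h2 := one_sub_prod_le_sum (univ.erase i) (fun j => g j (t j)) (fun j _ => hgn _ _)
        (fun j _ => hg1 _ _)
      have h3 : ∑ j ∈ univ.erase i, (1 - g j (t j)) ≤ ∑ j, (1 - g j (t j)) :=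
        sum_le_sum_of_subset_of_nonneg (erase_subset _ _) fun j _ _ => by linarith [hg1 j (t j)]
      have h4 : 0 ≤ 1 - ∏ j ∈ univ.erase i, g j (t j) := by
        linarith [prod_le_one (s := univ.erase i) (fun j _ => hgn j (t j)) fun j _ => hg1 j (t j)]
      have h5 : cliqueInd a (Function.update t i x) * g i x ≤ 1 :=
        mul_le_one₀ (H.cliqueInd_le_one _) (hgn _ _) (hg1 _ _)
      nlinarith [mul_le_mul_of_nonneg_right h5 h4]
    refine le_trans ?_ (sum_le_sum fun t _ => h1 t)
    rw [sum_sub_distrib, ← mul_sum, sum_comm]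
    have h6 : ∑ j : Fin r, ∑ t : Fin r → Fin n, (1 - g j (t j)) ≤
        ∑ j : Fin r, 2 * δ / P * n ^ r := sum_le_sum fun j _ => hgs j
    simp only [sum_const, card_univ, Fintype.card_fin, nsmul_eq_mul] at h6
    have h7 := hgl i x
    have h8 : (P - (δ + r * (2 * δ / P))) * (n : ℝ) ^ r =
      c - δ * n ^ r - r * (2 * δ / P * n ^ r) := by rw [hc]; ring
    rw [h8]
    linarith

section
variable {r n : ℕ} {a : Fin r → Fin r → Fin n → Fin n → ℝ} {D : Fin r → Fin r → ℝ} {d ε : ℝ}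

lemma IsQuasirandom.card_few_common_nbrs_le (H : IsQuasirandom a D d ε) (hn : 0 < n) (hd : 0 < d)
    (hεd : ε ≤ d / 2) {i j : Fin r} (hij : i ≠ j) (u : Fin n) :
    (#(univ.filter fun w => ∑ y, a i j u y * a i j w y < d ^ 2 / 4 * n) : ℝ) ≤
      4 * ε / d ^ 2 * n := by
  have hn' : (0 : ℝ) < n := by exact_mod_cast hn
  set W := univ.filter fun w => ∑ y, a i j u y * a i j w y < d ^ 2 / 4 * n with hW
  set X := univ.filter fun y => a i j u y = 1 with hX
  have hXs : ∀ f : Fin n → ℝ, ∑ y ∈ X, f y = ∑ y, a i j u y * f y := fun f => by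
    rw [hX, sum_filter]
    refine sum_congr rfl fun y _ => ?_
    rcases H.zero_one i j u y with h | h <;> simp [h]
  have hXc : d / 2 * n ≤ #X := by
    have h1 := hXs fun _ => 1
    simp only [sum_const, nsmul_eq_mul, mul_one] at h1
    rw [h1]
    refine le_trans ?_ (H.min_degree i j hij u)
    gcongr
    linarith [H.le_dens i j hij]
  have hdD := H.le_dens i j hij
  have h1 : ∑ w ∈ W, ∑ y ∈ X, (a i j w y - D i j) ≤ ∑ w ∈ W, -(d ^ 2 / 4 * n) := by
    refine sum_le_sum fun w hw => ?_
    have h2 := (mem_filter.mp hw).2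
    rw [sum_sub_distrib, hXs]
    simp only [sum_const, nsmul_eq_mul]
    nlinarith [mul_le_mul hXc hdD hd.le (Nat.cast_nonneg _)]
  have h3 := (abs_le.mp (H.cut i j hij W X)).1
  simp only [sum_const, nsmul_eq_mul] at h1
  have h4 : (#W : ℝ) * d ^ 2 * n ≤ (4 * ε * n) * n := by nlinarith
  have h5 := le_of_mul_le_mul_right h4 hn'
  rw [div_mul_eq_mul_div, le_div_iff₀ (by positivity)]
  exact h5

/-- The number of `(r - 1)`-tuples forming a clique both with `u` and with `w` in part `i`,
times `n`. -/
def codegree (a : Fin r → Fin r → Fin n → Fin n → ℝ) (i : Fin r) (u w : Fin n) : ℝ :=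
  ∑ t, cliqueInd a (Function.update t i u) * cliqueInd a (Function.update t i w)

lemma IsQuasirandom.le_codegree (H : IsQuasirandom a D d ε) (hn : 0 < n) (hd : 0 < d)
    (hd1 : d ≤ 1) (hε : 0 ≤ ε) (i : Fin r) (u w : Fin n)
    (h : ∀ j, j ≠ i → d ^ 2 / 4 * n ≤ ∑ y, a i j u y * a i j w y) :
    (d ^ (r * r) * (d ^ 2 / 4) ^ r - r * r * ε) * n ^ r ≤ codegree a i u w := by
  have h1 := H.le_sum_avoiding hn hd.le hε i (fun j y => a i j u y * a i j w y) (fun j y => by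
    rcases H.zero_one i j u y with h | h <;> rcases H.zero_one i j w y with h' | h' <;>
      simp [h, h'])
  have e : ∀ t : Fin r → Fin n, (∏ p ∈ ltPairsAvoiding i, a p.1 p.2 (t p.1) (t p.2)) *
        ∏ j ∈ univ.erase i, (a i j u (t j) * a i j w (t j)) =
      cliqueInd a (Function.update t i u) * cliqueInd a (Function.update t i w) := by
    intro t
    rw [H.cliqueInd_update, H.cliqueInd_update, prod_mul_distrib]
    have : (∏ p ∈ ltPairsAvoiding i, a p.1 p.2 (t p.1) (t p.2)) *
        (∏ p ∈ ltPairsAvoiding i, a p.1 p.2 (t p.1) (t p.2)) =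
        ∏ p ∈ ltPairsAvoiding i, a p.1 p.2 (t p.1) (t p.2) := by
      rw [← prod_mul_distrib]
      refine prod_congr rfl fun p _ => ?_
      rcases H.zero_one p.1 p.2 (t p.1) (t p.2) with h | h <;> simp [h]
    linear_combination (-(∏ j ∈ univ.erase i, a i j u (t j)) *
      ∏ j ∈ univ.erase i, a i j w (t j)) * this
  simp only [e] at h1
  unfold codegree
  have h2 : ∏ j ∈ univ.erase i, (d ^ 2 / 4 * n : ℝ) ≤
      ∏ j ∈ univ.erase i, ∑ y, a i j u y * a i j w y :=
    prod_le_prod (fun _ _ => by positivity) fun j hj => h j (ne_of_mem_erase hj)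
  have hcard : #(univ.erase i) = r - 1 := by simp
  rw [prod_const, hcard, mul_pow] at h2
  have hr : 0 < r := i.pos
  have hpow : (n : ℝ) ^ r = n * n ^ (r - 1) := by
    rw [← pow_succ', Nat.sub_add_cancel hr]
  have h3 : (d ^ 2 / 4) ^ r ≤ (d ^ 2 / 4) ^ (r - 1) :=
    pow_le_pow_of_le_one (by positivity) (by nlinarith) (Nat.sub_le _ _)
  have h4 := H.pow_le_prod hd hd1 (E := ltPairsAvoiding i) (filter_subset _ _)
  have h5 : d ^ (r * r) * (n * ((d ^ 2 / 4) ^ r * n ^ (r - 1))) ≤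
      (∏ p ∈ ltPairsAvoiding i, D p.1 p.2) *
        (n * ∏ j ∈ univ.erase i, ∑ y, a i j u y * a i j w y) := by
    refine mul_le_mul h4 ?_ (by positivity) ((by positivity : (0 : ℝ) ≤ d ^ (r * r)).trans h4)
    refine mul_le_mul_of_nonneg_left (le_trans ?_ h2) (by positivity)
    gcongr
  rw [sub_mul]
  refine le_trans ?_ h1
  have h6 : d ^ (r * r) * (d ^ 2 / 4) ^ r * (n : ℝ) ^ r =
      d ^ (r * r) * (n * ((d ^ 2 / 4) ^ r * n ^ (r - 1))) := by rw [hpow]; ring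
  rw [h6]
  linarith

lemma IsQuasirandom.card_codegree_lt_le (H : IsQuasirandom a D d ε) (hn : 0 < n) (hd : 0 < d)
    (hd1 : d ≤ 1) (hε : 0 ≤ ε) (hεd : ε ≤ d / 2) (i : Fin r) (u : Fin n) :
    (#(univ.filter fun w => codegree a i u w <
      (d ^ (r * r) * (d ^ 2 / 4) ^ r - r * r * ε) * n ^ r) : ℝ) ≤ r * (4 * ε / d ^ 2 * n) := by
  classical
  have hsub : (univ.filter fun w => codegree a i u w <
      (d ^ (r * r) * (d ^ 2 / 4) ^ r - r * r * ε) * n ^ r) ⊆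
      (univ.erase i).biUnion fun j =>
        univ.filter fun w => ∑ y, a i j u y * a i j w y < d ^ 2 / 4 * n := by
    intro w hw
    by_contra hcon
    simp only [mem_biUnion, mem_erase, mem_filter, mem_univ, true_and, and_true, not_exists,
      not_and, not_lt] at hcon
    exact absurd (mem_filter.mp hw).2 (not_lt.mpr (H.le_codegree hn hd hd1 hε i u w hcon))
  calc _ ≤ ((∑ j ∈ univ.erase i,
        #(univ.filter fun w => ∑ y, a i j u y * a i j w y < d ^ 2 / 4 * n) : ℕ) : ℝ) := by
        exact_mod_cast (card_le_card hsub).trans card_biUnion_le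
    _ ≤ ∑ j ∈ univ.erase i, 4 * ε / d ^ 2 * n := by
        push_cast
        exact sum_le_sum fun j hj => H.card_few_common_nbrs_le hn hd hεd (ne_of_mem_erase hj).symm u
    _ ≤ ∑ j : Fin r, 4 * ε / d ^ 2 * n :=
        sum_le_sum_of_subset_of_nonneg (erase_subset _ _) fun _ _ _ => by positivity
    _ = _ := by simp

lemma IsQuasirandom.sum_codegree_mul_le (H : IsQuasirandom a D d ε)
    (y : Fin r → Fin n → ℝ) (i : Fin r) :
    ∑ u, ∑ w, codegree a i u w * |y i u - y i w| ≤
      2 * n ^ 2 * ∑ t, cliqueInd a t * |∑ j, y j (t j)| := by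
  set F : (Fin r → Fin n) → ℝ := fun t => cliqueInd a t * |∑ j, y j (t j)| with hF
  have hsum : ∀ t x, ∑ j, y j (Function.update t i x j) = y i x + ∑ j ∈ univ.erase i, y j (t j) := by
    intro t x
    rw [← add_sum_erase univ _ (mem_univ i)]
    simp only [Function.update_self]
    congr 1
    exact sum_congr rfl fun j hj => by rw [Function.update_of_ne (ne_of_mem_erase hj)]
  have hpt : ∀ t u w, cliqueInd a (Function.update t i u) * cliqueInd a (Function.update t i w) *
      |y i u - y i w| ≤ F (Function.update t i u) + F (Function.update t i w) := by
    intro t u w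
    simp only [hF, hsum]
    have h1 : |y i u - y i w| ≤ |y i u + ∑ j ∈ univ.erase i, y j (t j)| +
        |y i w + ∑ j ∈ univ.erase i, y j (t j)| := by
      refine le_trans (le_of_eq ?_) (abs_sub _ _)
      congr 1; ring
    have h2 := abs_nonneg (y i u + ∑ j ∈ univ.erase i, y j (t j))
    have h3 := abs_nonneg (y i w + ∑ j ∈ univ.erase i, y j (t j))
    rcases H.cliqueInd_zero_one (Function.update t i u) with hu | hu <;>
      rcases H.cliqueInd_zero_one (Function.update t i w) with hw | hw <;>
      simp only [hu, hw] <;> linarith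
  calc ∑ u, ∑ w, codegree a i u w * |y i u - y i w|
      = ∑ t, ∑ u, ∑ w, cliqueInd a (Function.update t i u) * cliqueInd a (Function.update t i w) *
          |y i u - y i w| := by
        simp only [codegree, sum_mul]
        exact (sum_congr rfl fun u _ => sum_comm).trans sum_comm
    _ ≤ ∑ t, ∑ u, ∑ w, (F (Function.update t i u) + F (Function.update t i w)) :=
        sum_le_sum fun t _ => sum_le_sum fun u _ => sum_le_sum fun w _ => hpt t u w
    _ = 2 * n * ∑ t, ∑ u, F (Function.update t i u) := by
        simp only [sum_add_distrib, sum_const, card_univ, Fintype.card_fin, nsmul_eq_mul,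
          ← mul_sum]
        ring
    _ = 2 * n ^ 2 * ∑ t, F t := by
        rw [sum_sum_update]; ring

end

/-- A Poincaré-type inequality on a graph of large minimum degree. -/
lemma sum_sum_abs_sub_le {n : ℕ} (good : Fin n → Fin n → Prop) [∀ u, DecidablePred (good u)]
    (hgood : ∀ u, (#(univ.filter fun w => ¬ good u w) : ℝ) ≤ n / 4) (y : Fin n → ℝ) :
    ∑ u, ∑ w, |y u - y w| ≤ 4 * ∑ u, ∑ w, if good u w then |y u - y w| else 0 := by
  rcases Nat.eq_zero_or_pos n with rfl | hn
  · simp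
  have hn' : (0 : ℝ) < n := by exact_mod_cast hn
  set z : Fin n → Fin n → ℝ := fun u w => if good u w then |y u - y w| else 0 with hz
  have hz0 : ∀ u w, 0 ≤ z u w := fun u w => by
    simp only [hz]; split_ifs <;> positivity
  have key : ∀ u w, n / 2 * |y u - y w| ≤ ∑ m, (z u m + z w m) := by
    intro u w
    set G := univ.filter fun m => good u m ∧ good w m with hG
    have hcard : (n : ℝ) / 2 ≤ #G := by
      have h1 : (n : ℝ) ≤ #G + #(univ.filter fun m => ¬ good u m) +
          #(univ.filter fun m => ¬ good w m) := by
        have h2 : (univ : Finset (Fin n)) ⊆ G ∪ (univ.filter fun m => ¬ good u m) ∪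
            (univ.filter fun m => ¬ good w m) := by
          intro m _
          simp only [hG, mem_union, mem_filter, mem_univ, true_and]
          tauto
        have h3 := (card_le_card h2).trans
          ((card_union_le _ _).trans (Nat.add_le_add_right (card_union_le _ _) _))
        rw [card_univ, Fintype.card_fin] at h3
        exact_mod_cast h3
      linarith [hgood u, hgood w]
    calc n / 2 * |y u - y w| ≤ #G * |y u - y w| := by gcongr
      _ = ∑ m ∈ G, |y u - y w| := by simp
      _ ≤ ∑ m ∈ G, (z u m + z w m) := by
          refine sum_le_sum fun m hm => ?_
          have h := (mem_filter.mp hm).2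
          simp only [hz, h.1, h.2, if_true]
          rw [abs_sub_comm (y w) (y m)]
          exact abs_sub_le _ _ _
      _ ≤ _ := sum_le_sum_of_subset_of_nonneg (subset_univ _) fun m _ _ =>
          add_nonneg (hz0 _ _) (hz0 _ _)
  have h1 : ∑ u, ∑ w, n / 2 * |y u - y w| ≤ ∑ u, ∑ w, ∑ m, (z u m + z w m) :=
    sum_le_sum fun u _ => sum_le_sum fun w _ => key u w
  simp only [← mul_sum, sum_add_distrib, sum_const, card_univ, Fintype.card_fin,
    nsmul_eq_mul] at h1
  refine le_of_mul_le_mul_left (a := (n : ℝ) / 2) ?_ (by positivity)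
  linarith

lemma card_mul_sum_abs_sub_mean_le {n : ℕ} (y : Fin n → ℝ) (m : ℝ) (hm : n * m = ∑ u, y u) :
    n * ∑ u, |y u - m| ≤ ∑ u, ∑ w, |y u - y w| := by
  rw [mul_sum]
  refine sum_le_sum fun u _ => ?_
  calc n * |y u - m| = |∑ w, (y u - y w)| := by
        rw [sum_sub_distrib, ← hm]
        simp only [sum_const, card_univ, Fintype.card_fin, nsmul_eq_mul]
        rw [← mul_sub, abs_mul, Nat.abs_cast]
    _ ≤ _ := abs_sum_le_sum_abs _ _

lemma IsQuasirandom.sum_abs_sub_mean_le {r n : ℕ} {a : Fin r → Fin r → Fin n → Fin n → ℝ}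
    {D : Fin r → Fin r → ℝ} {d ε : ℝ} (H : IsQuasirandom a D d ε) (hn : 0 < n) {κ : ℝ}
    (hκ : 0 ≤ κ) (i : Fin r)
    (hgood : ∀ u, (#(univ.filter fun w => codegree a i u w < κ * n ^ r) : ℝ) ≤ n / 4)
    (y : Fin r → Fin n → ℝ) (m : ℝ) (hm : n * m = ∑ u, y i u) :
    κ * n ^ r * ∑ u, |y i u - m| ≤ 8 * n * ∑ t, cliqueInd a t * |∑ j, y j (t j)| := by
  classical
  have hn' : (0 : ℝ) < n := by exact_mod_cast hn
  have h1 := sum_sum_abs_sub_le (fun u w => ¬ codegree a i u w < κ * n ^ r)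
    (by simpa using hgood) (y i)
  have h2 := card_mul_sum_abs_sub_mean_le (y i) m hm
  have h3 := H.sum_codegree_mul_le y i
  have h4 : κ * n ^ r * ∑ u, ∑ w,
      (if ¬ codegree a i u w < κ * n ^ r then |y i u - y i w| else 0) ≤
      ∑ u, ∑ w, codegree a i u w * |y i u - y i w| := by
    simp only [mul_sum]
    refine sum_le_sum fun u _ => sum_le_sum fun w _ => ?_
    split_ifs with h
    · rw [mul_zero]
      exact mul_nonneg (sum_nonneg fun t _ => mul_nonneg (H.cliqueInd_nonneg _)
        (H.cliqueInd_nonneg _)) (abs_nonneg _)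
    · exact mul_le_mul_of_nonneg_right (not_lt.mp h) (abs_nonneg _)
  have hκn : 0 ≤ κ * (n : ℝ) ^ r := by positivity
  have h5 := mul_le_mul_of_nonneg_left (h2.trans h1) hκn
  refine le_of_mul_le_mul_left (a := (n : ℝ)) ?_ hn'
  nlinarith

lemma card_mul_sum_mul_apply {r n : ℕ} (i : Fin r) (w : (Fin r → Fin n) → ℝ) (φ : Fin n → ℝ) :
    n * ∑ t : Fin r → Fin n, w t * φ (t i) = ∑ u, φ u * ∑ t, w (Function.update t i u) := by
  rw [← sum_sum_update i fun t => w t * φ (t i), sum_comm]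
  refine sum_congr rfl fun u _ => ?_
  rw [mul_sum]
  exact sum_congr rfl fun t _ => by rw [Function.update_self, mul_comm]

/-- The linear programming dual of the existence of a perfect fractional weighting with all
degrees equal to `P / 2 * n ^ r`. -/
lemma half_mul_sum_le_sum_max {r n : ℕ} (hr : 0 < r) (hn : 0 < n) {c w : (Fin r → Fin n) → ℝ}
    (hc : ∀ t, 0 ≤ c t) {P η κ : ℝ} (hP : 0 < P) (hκ : 0 < κ) (hηP : η ≤ P / 4)
    (hη : 0 ≤ η) (hηκ : η * (16 * r) ≤ κ * P ^ r)
    (hwc : ∀ t, w t ≤ c t) (hcw : ∀ t, P ^ r * c t ≤ w t)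
    (hwu : ∀ i x, ∑ t, w (Function.update t i x) ≤ P * n ^ r)
    (hwl : ∀ i x, (P - η) * n ^ r ≤ ∑ t, w (Function.update t i x))
    (y : Fin r → Fin n → ℝ)
    (hy : ∀ i m, n * m = ∑ u, y i u →
      κ * n ^ r * ∑ u, |y i u - m| ≤ 8 * n * ∑ t, c t * |∑ j, y j (t j)|) :
    P / 2 * ∑ t : Fin r → Fin n, ∑ j, y j (t j) ≤ ∑ t, c t * max 0 (∑ j, y j (t j)) := by
  have hn' : (0 : ℝ) < n := by exact_mod_cast hn
  have hnr : (0 : ℝ) < (n : ℝ) ^ r := by positivity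
  set Y : (Fin r → Fin n) → ℝ := fun t => ∑ j, y j (t j) with hY
  change P / 2 * ∑ t, Y t ≤ ∑ t, c t * max 0 (Y t)
  have hrhs : 0 ≤ ∑ t, c t * max 0 (Y t) :=
    sum_nonneg fun t _ => mul_nonneg (hc t) (le_max_left _ _)
  set m : Fin r → ℝ := fun j => (∑ u, y j u) / n with hm
  have hm' : ∀ j, n * m j = ∑ u, y j u := fun j => by simp only [hm]; field_simp
  set M := ∑ j, m j with hM
  have hYM : ∑ t, Y t = n ^ r * M := by
    refine mul_left_cancel₀ hn'.ne' ?_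
    simp only [hY]
    rw [sum_comm, mul_sum]
    simp only [card_mul_sum_apply, ← hm']
    rw [hM, mul_sum, mul_sum]
    exact sum_congr rfl fun j _ => by ring
  rcases le_or_gt M 0 with hM0 | hM0
  · refine le_trans ?_ hrhs
    rw [hYM]
    exact mul_nonpos_of_nonneg_of_nonpos (by positivity)
      (mul_nonpos_of_nonneg_of_nonpos hnr.le hM0)
  set T := ∑ t, c t * |Y t| with hT
  have hW : ∀ j, ∑ u, ∑ t, w (Function.update t j u) = n * ∑ t, w t := fun j => by
    rw [sum_comm, sum_sum_update]
  have hS : 3 / 4 * P * n ^ r ≤ ∑ t, w t := by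
    refine le_of_mul_le_mul_left (a := (n : ℝ)) ?_ hn'
    rw [← hW ⟨0, hr⟩]
    calc (n : ℝ) * (3 / 4 * P * n ^ r) = ∑ u : Fin n, 3 / 4 * P * (n : ℝ) ^ r := by simp
      _ ≤ _ := sum_le_sum fun u _ => le_trans
        (mul_le_mul_of_nonneg_right (by linarith) hnr.le) (hwl _ u)
  have hdev : ∀ j, n * m j * ∑ t, w t - η * n ^ r * ∑ u, |y j u - m j| ≤
      n * ∑ t, w t * y j (t j) := by
    intro j
    rw [card_mul_sum_mul_apply]
    have h0 : ∑ u, (y j u - m j) = 0 := by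
      rw [sum_sub_distrib, ← hm']
      simp
    have h1 : ∑ u, y j u * ∑ t, w (Function.update t j u) = n * m j * ∑ t, w t +
        ∑ u, (y j u - m j) * (∑ t, w (Function.update t j u) - P * n ^ r) := by
      have h4 : ∀ u, y j u * ∑ t, w (Function.update t j u) =
          m j * ∑ t, w (Function.update t j u) + (y j u - m j) * (P * n ^ r) +
          (y j u - m j) * (∑ t, w (Function.update t j u) - P * n ^ r) := fun u => by ring
      rw [sum_congr rfl fun u _ => h4 u, sum_add_distrib, sum_add_distrib, ← mul_sum, ← sum_mul,
        h0, hW]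
      ring
    have h2 : ∀ u, -(η * n ^ r * |y j u - m j|) ≤
        (y j u - m j) * (∑ t, w (Function.update t j u) - P * n ^ r) := by
      intro u
      refine le_trans (neg_le_neg ?_) (neg_abs_le _)
      rw [abs_mul, mul_comm]
      refine mul_le_mul_of_nonneg_right ?_ (abs_nonneg _)
      rw [abs_le]
      constructor <;> nlinarith [hwu j u, hwl j u, mul_nonneg hη hnr.le]
    have h3 := sum_le_sum fun u (_ : u ∈ univ) => h2 u
    rw [sum_neg_distrib, ← mul_sum] at h3
    linarith
  have hdev' : ∀ j, η * n ^ r * ∑ u, |y j u - m j| ≤ 8 * n * (η / κ) * T := by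
    intro j
    have h1 := mul_le_mul_of_nonneg_left (hy j (m j) (hm' j)) (div_nonneg hη hκ.le)
    calc _ = η / κ * (κ * n ^ r * ∑ u, |y j u - m j|) := by field_simp
      _ ≤ _ := h1
      _ = _ := by rw [hT]; ring
  have hT0 : 0 ≤ T := sum_nonneg fun t _ => mul_nonneg (hc t) (abs_nonneg _)
  have hwY : M * ∑ t, w t - 8 * r * (η / κ) * T ≤ ∑ t, w t * Y t := by
    refine le_of_mul_le_mul_left (a := (n : ℝ)) ?_ hn'
    have e : n * ∑ t, w t * Y t = ∑ j, n * ∑ t, w t * y j (t j) := by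
      rw [← mul_sum, sum_comm]
      simp only [hY, mul_sum]
    rw [e]
    calc _ = ∑ j : Fin r, (n * m j * ∑ t, w t - 8 * n * (η / κ) * T) := by
          rw [sum_sub_distrib, ← sum_mul, ← mul_sum]
          simp
          ring
      _ ≤ _ := sum_le_sum fun j _ => by linarith [hdev j, hdev' j]
  have hηκ' : 8 * r * (η / κ) ≤ P ^ r / 2 := by
    rw [mul_div_assoc', div_le_iff₀ hκ]
    linarith
  have hpt : ∀ t, 2 / 3 * (w t * Y t) + 1 / 3 * P ^ r * (c t * |Y t|) ≤ c t * max 0 (Y t) := by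
    intro t
    have h1 : 2 / 3 * Y t + 1 / 3 * |Y t| ≤ max 0 (Y t) := by
      rcases le_total 0 (Y t) with h | h
      · rw [abs_of_nonneg h, max_eq_right h]; linarith
      · rw [abs_of_nonpos h, max_eq_left h]; linarith
    have hw0 : 0 ≤ w t := le_trans (mul_nonneg (by positivity) (hc t)) (hcw t)
    have h2 := mul_le_mul_of_nonneg_left h1 hw0
    have h3 := mul_le_mul_of_nonneg_right (hwc t) (le_max_left 0 (Y t))
    have h4 := mul_le_mul_of_nonneg_right (hcw t) (abs_nonneg (Y t))
    linarith
  have hfin := sum_le_sum fun t (_ : t ∈ univ) => hpt t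
  rw [sum_add_distrib, ← mul_sum, ← mul_sum, ← hT] at hfin
  rw [hYM]
  nlinarith [mul_le_mul_of_nonneg_left hS hM0.le, mul_le_mul_of_nonneg_right hηκ' hT0]

/-- Farkas-type criterion for the existence of a weighting bounded by `c` with all degrees `b`. -/
lemma exists_weight_of_dual {r n : ℕ} (hn : 0 < n) {c : (Fin r → Fin n) → ℝ}
    (hc : ∀ t, 0 ≤ c t) (b : ℝ)
    (h : ∀ y : Fin r → Fin n → ℝ,
      b * ∑ t : Fin r → Fin n, ∑ j, y j (t j) ≤ ∑ t, c t * max 0 (∑ j, y j (t j))) :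
    ∃ x : (Fin r → Fin n) → ℝ, (∀ t, 0 ≤ x t) ∧ (∀ t, x t ≤ c t) ∧
      ∀ i u, ∑ t, x (Function.update t i u) = b * n ^ r := by
  have hn' : (0 : ℝ) < n := by exact_mod_cast hn
  let L : ((Fin r → Fin n) → ℝ) →ₗ[ℝ] (Fin r × Fin n → ℝ) :=
    { toFun := fun x q => ∑ t, x (Function.update t q.1 q.2)
      map_add' := fun x x' => by ext q; simp [sum_add_distrib]
      map_smul' := fun s x => by ext q; simp [mul_sum] }
  have hLc : Continuous L := L.continuous_of_finiteDimensional
  by_contra hcon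
  have hnot : (fun _ => b * (n : ℝ) ^ r) ∉ L '' Set.Icc 0 c := by
    rintro ⟨x, hx, hxe⟩
    exact hcon ⟨x, hx.1, hx.2, fun i u => congrFun hxe (i, u)⟩
  obtain ⟨f, s, hfs, hs⟩ := geometric_hahn_banach_closed_point
    ((convex_Icc (0 : (Fin r → Fin n) → ℝ) c).linear_image L) (isCompact_Icc.image hLc).isClosed hnot
  set y : Fin r → Fin n → ℝ := fun i u => f (Pi.single (i, u) 1) with hy
  have hf : ∀ z, f z = ∑ i, ∑ u, z (i, u) * y i u := by
    intro z
    conv_lhs => rw [← Finset.univ_sum_single z]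
    rw [map_sum, Fintype.sum_prod_type]
    refine sum_congr rfl fun i _ => sum_congr rfl fun u _ => ?_
    rw [hy, ← smul_eq_mul, ← map_smul, ← Pi.single_smul, smul_eq_mul, mul_one]
  set Y : (Fin r → Fin n) → ℝ := fun t => ∑ j, y j (t j) with hY
  have h1 := hfs (L fun t => if 0 ≤ Y t then c t else 0) ⟨_, ⟨fun t => by
    simp only [Pi.zero_apply]; split_ifs; exacts [hc t, le_rfl], fun t => by
    dsimp only; split_ifs; exacts [le_rfl, hc t]⟩, rfl⟩
  have h2 := h1.trans hs
  have e1 : f (L fun t => if 0 ≤ Y t then c t else 0) = n * ∑ t, c t * max 0 (Y t) := by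
    have : ∀ t, c t * max 0 (Y t) = ∑ j, (if 0 ≤ Y t then c t else 0) * y j (t j) := by
      intro t
      rw [← mul_sum]
      change _ = _ * Y t
      split_ifs with h0
      · rw [max_eq_right h0]
      · rw [max_eq_left (not_le.mp h0).le]; simp
    simp only [this]
    rw [sum_comm, hf, mul_sum]
    refine sum_congr rfl fun i _ => ?_
    rw [card_mul_sum_mul_apply i (fun t => if 0 ≤ Y t then c t else 0)]
    exact sum_congr rfl fun u _ => mul_comm _ _
  have e2 : f (fun _ => b * (n : ℝ) ^ r) = n * (b * ∑ t, Y t) := by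
    simp only [hY]
    rw [sum_comm, hf, mul_left_comm, mul_sum, mul_sum]
    refine sum_congr rfl fun i _ => ?_
    rw [card_mul_sum_apply, ← mul_sum]
    ring
  rw [e1, e2] at h2
  exact absurd (lt_of_mul_lt_mul_left h2 hn'.le) (not_lt.mpr (h y))

/-- In a quasirandom `r`-partite graph there is a fractional weighting of the transversal cliques
giving every vertex exactly half of the expected clique degree. -/
lemma exists_fractional_weight (r : ℕ) (hr : 0 < r) (d : ℝ) (hd : 0 < d) (hd1 : d ≤ 1) :
    ∃ ε₀ : ℝ, 0 < ε₀ ∧ ∀ ε : ℝ, 0 < ε → ε ≤ ε₀ → ∀ n : ℕ, 0 < n →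
    ∀ (a : Fin r → Fin r → Fin n → Fin n → ℝ) (D : Fin r → Fin r → ℝ),
    IsQuasirandom a D d ε →
    ∃ x : (Fin r → Fin n) → ℝ, (∀ t, 0 ≤ x t) ∧ (∀ t, x t ≤ cliqueInd a t) ∧
      ∀ i u, ∑ t, x (Function.update t i u) = (∏ p ∈ ltPairs r, D p.1 p.2) / 2 * n ^ r := by
  have hr' : (0 : ℝ) < r := by exact_mod_cast hr
  set p := d ^ (r * r) with hp
  have hp0 : 0 < p := by positivity
  set β := (d ^ 2 / 4) ^ r with hβ
  have hβ0 : 0 < β := by positivity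
  set κ := p * β / 2 with hκ
  have hκ0 : 0 < κ := by positivity
  set A : ℝ := (r * r + r) * (1 + r * (2 / p)) with hA
  have hA0 : 0 < A := by positivity
  have hev : ∀ K c : ℝ, 0 < c → ∀ᶠ ε in nhdsWithin (0 : ℝ) (Set.Ioi 0), K * ε ≤ c := by
    intro K c hc
    have : Filter.Tendsto (fun ε : ℝ => K * ε) (nhdsWithin 0 (Set.Ioi 0)) (nhds (K * 0)) :=
      ((continuous_const.mul continuous_id).tendsto 0).mono_left nhdsWithin_le_nhds
    rw [mul_zero] at this
    exact (this.eventually (gt_mem_nhds hc)).mono fun _ h => h.le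
  obtain ⟨ε₀, ⟨h1, h2, h3, h4, h5⟩, hε₀⟩ := ((((hev (r * r) (p * β / 2) (by positivity)).and
    ((hev 1 (d / 2) (by positivity)).and ((hev (r * (4 / d ^ 2)) (1 / 4) (by norm_num)).and
    ((hev (A * (16 * r)) (κ * p ^ r) (by positivity)).and
    (hev A (p / 4) (by positivity)))))).and self_mem_nhdsWithin)).exists
  refine ⟨ε₀, hε₀, fun ε hε hεε n hn a D H => ?_⟩
  have hn' : (0 : ℝ) < n := by exact_mod_cast hn
  have mono : ∀ K c : ℝ, 0 ≤ K → K * ε₀ ≤ c → K * ε ≤ c := fun K c hK h =>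
    (mul_le_mul_of_nonneg_left hεε hK).trans h
  replace h1 := mono _ _ (by positivity) h1
  replace h2 := mono _ _ (by positivity) h2
  replace h3 := mono _ _ (by positivity) h3
  replace h4 := mono _ _ (by positivity) h4
  replace h5 := mono _ _ hA0.le h5
  rw [one_mul] at h2
  set P := ∏ q ∈ ltPairs r, D q.1 q.2 with hP
  have hpP : p ≤ P := H.pow_le_prod hd hd1 subset_rfl
  have hP0 : 0 < P := hp0.trans_le hpP
  set δ := (r * r + r) * ε with hδ
  have hδ0 : 0 ≤ δ := by positivity
  set η := δ + r * (2 * δ / P) with hη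
  have hη0 : 0 ≤ η := by positivity
  have hηA : η ≤ A * ε := by
    calc η ≤ δ + r * (2 * δ / p) := by rw [hη]; gcongr
      _ = A * ε := by rw [hA, hδ]; ring
  have hδη : δ ≤ η := le_add_of_nonneg_right (by positivity)
  obtain ⟨w, hw1, hw2, hw3, hw4⟩ := exists_almost_regular_weight H hn hd hε.le
    (by linarith) hP hP0 hδ (by linarith)
  refine exists_weight_of_dual hn H.cliqueInd_nonneg (P / 2) fun y => ?_
  refine half_mul_sum_le_sum_max hr hn H.cliqueInd_nonneg hP0 hκ0 (η := η) (by linarith) hη0 ?_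
    hw1 hw2 hw3 hw4 y fun i m hm => ?_
  · calc η * (16 * r) ≤ A * ε * (16 * r) := by gcongr
      _ = A * (16 * r) * ε := by ring
      _ ≤ κ * p ^ r := h4
      _ ≤ κ * P ^ r := by gcongr
  · refine H.sum_abs_sub_mean_le hn hκ0.le i (fun u => ?_) y m hm
    have h6 := H.card_codegree_lt_le hn hd hd1 hε.le h2 i u
    have h7 : (#(univ.filter fun w => codegree a i u w < κ * n ^ r) : ℝ) ≤
        #(univ.filter fun w => codegree a i u w <
      (d ^ (r * r) * (d ^ 2 / 4) ^ r - r * r * ε) * n ^ r) := by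
      have hle : κ ≤ d ^ (r * r) * (d ^ 2 / 4) ^ r - r * r * ε := by
        rw [← hp, ← hβ, hκ]; linarith
      refine Nat.cast_le.mpr <| card_le_card (monotone_filter_right _ fun w _ hw => hw.trans_le ?_)
      gcongr
    refine h7.trans (h6.trans ?_)
    calc (r : ℝ) * (4 * ε / d ^ 2 * (n : ℝ)) = r * (4 / d ^ 2) * ε * n := by ring
      _ ≤ 1 / 4 * (n : ℝ) := by gcongr
      _ = (n : ℝ) / 4 := by ring

lemma bernoulli_mgf_le {p c : ℝ} (hp0 : 0 ≤ p) (hp1 : p ≤ 1) (hc : |c| ≤ 1) :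
    p * Real.exp (c * (1 - p)) + (1 - p) * Real.exp (c * (0 - p)) ≤ Real.exp (c ^ 2) := by
  have hexp : ∀ z : ℝ, |z| ≤ 1 → Real.exp z ≤ 1 + z + z ^ 2 := fun z hz => by
    linarith [(abs_le.mp (Real.abs_exp_sub_one_sub_id_le hz)).2]
  have h1 := hexp (c * (1 - p)) (by
    rw [abs_mul]
    exact mul_le_one₀ hc (abs_nonneg _) (abs_le.mpr ⟨by linarith, by linarith⟩))
  have h2 := hexp (c * (0 - p)) (by
    rw [abs_mul]
    exact mul_le_one₀ hc (abs_nonneg _) (abs_le.mpr ⟨by linarith, by linarith⟩))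
  have h3 := mul_le_mul_of_nonneg_left h1 hp0
  have h4 := mul_le_mul_of_nonneg_left h2 (sub_nonneg.mpr hp1)
  have h5 := Real.add_one_le_exp (c ^ 2)
  have h6 : p * (1 - p) ≤ 1 := by nlinarith
  have h7 := mul_le_mul_of_nonneg_left h6 (sq_nonneg c)
  nlinarith

/-- Derandomized independent rounding of `p`, by the exponential moment method. -/
lemma exists_rounding {α ι : Type*} [Fintype ι] [DecidableEq α] (p : α → ℝ)
    (hp0 : ∀ a, 0 ≤ p a) (hp1 : ∀ a, p a ≤ 1) (c : ι → α → ℝ) (hc : ∀ v a, |c v a| ≤ 1)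
    (s : Finset α) :
    ∃ ω : α → ℝ, (∀ a, ω a = 0 ∨ ω a = 1) ∧
      ∑ v, Real.exp (∑ a ∈ s, (c v a * (ω a - p a) - c v a ^ 2)) ≤ Fintype.card ι := by
  induction s using Finset.induction_on with
  | empty => exact ⟨fun _ => 0, by simp, by simp⟩
  | insert q s hq ih =>
    obtain ⟨ω, hω, hsum⟩ := ih
    set S : ι → ℝ := fun v => ∑ a ∈ s, (c v a * (ω a - p a) - c v a ^ 2) with hS
    have hupd : ∀ b v, ∑ a ∈ insert q s, (c v a * (Function.update ω q b a - p a) - c v a ^ 2) =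
        c v q * (b - p q) - c v q ^ 2 + S v := by
      intro b v
      rw [sum_insert hq, Function.update_self]
      congr 1
      refine sum_congr rfl fun a ha => ?_
      rw [Function.update_of_ne (ne_of_mem_of_not_mem ha hq)]
    have havg : p q * ∑ v, Real.exp (c v q * (1 - p q) - c v q ^ 2 + S v) +
        (1 - p q) * ∑ v, Real.exp (c v q * (0 - p q) - c v q ^ 2 + S v) ≤
        ∑ v, Real.exp (S v) := by
      rw [mul_sum, mul_sum, ← sum_add_distrib]
      refine sum_le_sum fun v _ => ?_
      have h1 := bernoulli_mgf_le (hp0 q) (hp1 q) (hc v q)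
      have h2 := mul_le_mul_of_nonneg_right h1
        (mul_nonneg (Real.exp_pos (-c v q ^ 2)).le (Real.exp_pos (S v)).le)
      have h3 : Real.exp (c v q ^ 2) * Real.exp (-c v q ^ 2) = 1 := by
        rw [← Real.exp_add]; simp
      simp only [Real.exp_add, sub_eq_add_neg (c v q * _) (c v q ^ 2)]
      calc _ = (p q * Real.exp (c v q * (1 - p q)) + (1 - p q) * Real.exp (c v q * (0 - p q))) *
            (Real.exp (-c v q ^ 2) * Real.exp (S v)) := by ring
        _ ≤ _ := h2
        _ = Real.exp (S v) := by rw [← mul_assoc, h3, one_mul]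
    have hex : ∃ b : ℝ, (b = 0 ∨ b = 1) ∧
        ∑ v, Real.exp (c v q * (b - p q) - c v q ^ 2 + S v) ≤ ∑ v, Real.exp (S v) := by
      by_contra! hcon
      have h0 := hcon 0 (Or.inl rfl)
      have h1 := hcon 1 (Or.inr rfl)
      rcases (hp0 q).eq_or_lt with h | h
      · rw [← h] at havg h0; linarith
      · nlinarith [mul_lt_mul_of_pos_left h1 h,
          mul_le_mul_of_nonneg_left h0.le (sub_nonneg.mpr (hp1 q))]
    obtain ⟨b, hb, hle⟩ := hex
    refine ⟨Function.update ω q b, fun a => ?_, ?_⟩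
    · by_cases ha : a = q
      · subst ha; simpa using hb
      · rw [Function.update_of_ne ha]; exact hω a
    · simp only [hupd]
      exact hle.trans hsum

lemma exists_rounding_abs {α ι : Type*} [Fintype ι] [Nonempty ι] [DecidableEq α] (p : α → ℝ)
    (hp0 : ∀ a, 0 ≤ p a) (hp1 : ∀ a, p a ≤ 1) (inc : ι → α → Prop)
    [∀ v, DecidablePred (inc v)] (s : Finset α) {l N : ℝ} (hl0 : 0 < l) (hl1 : l ≤ 1)
    (hN : ∀ v, (#(s.filter (inc v)) : ℝ) ≤ N) :
    ∃ ω : α → ℝ, (∀ a, ω a = 0 ∨ ω a = 1) ∧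
      ∀ v, |∑ a ∈ s.filter (inc v), (ω a - p a)| ≤
        Real.log (2 * Fintype.card ι) / l + l * N := by
  obtain ⟨ω, hω, hsum⟩ := exists_rounding p hp0 hp1
    (fun (q : ι × Bool) a => if inc q.1 a then (if q.2 then l else -l) else 0)
    (fun q a => by
      split_ifs
      · rwa [abs_of_pos hl0]
      · rwa [abs_neg, abs_of_pos hl0]
      · simp) s
  refine ⟨ω, hω, fun v => ?_⟩
  have hbound : ∀ b : Bool, (if b then l else -l) * ∑ a ∈ s.filter (inc v), (ω a - p a) ≤
      Real.log (2 * Fintype.card ι) + l ^ 2 * N := by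
    intro b
    have h1 := (single_le_sum (f := fun q : ι × Bool => Real.exp (∑ a ∈ s,
      ((if inc q.1 a then (if q.2 then l else -l) else 0) * (ω a - p a) -
        (if inc q.1 a then (if q.2 then l else -l) else 0) ^ 2)))
      (fun q _ => (Real.exp_pos _).le) (mem_univ (v, b))).trans hsum
    have hcard : (Fintype.card (ι × Bool) : ℝ) = 2 * Fintype.card ι := by
      simp [mul_comm]
    rw [hcard] at h1
    have hpos : (0 : ℝ) < 2 * Fintype.card ι := by
      have := Fintype.card_pos (α := ι); positivity
    have h2 := (Real.le_log_iff_exp_le hpos).mpr h1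
    have h3 : ∑ a ∈ s, ((if inc v a then (if b then l else -l) else 0) * (ω a - p a) -
        (if inc v a then (if b then l else -l) else 0) ^ 2) =
        (if b then l else -l) * ∑ a ∈ s.filter (inc v), (ω a - p a) -
          l ^ 2 * #(s.filter (inc v)) := by
      rw [mul_sum, sum_filter, mul_comm, ← nsmul_eq_mul, ← sum_const, sum_filter,
        ← sum_sub_distrib]
      refine sum_congr rfl fun a _ => ?_
      cases b <;> split_ifs <;> simp
    dsimp only at h2
    rw [h3] at h2
    linarith [mul_le_mul_of_nonneg_left (hN v) (sq_nonneg l)]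
  have h1 := hbound true
  have h2 := hbound false
  simp only [if_true, Bool.false_eq_true, if_false] at h1 h2
  have h3 : |∑ a ∈ s.filter (inc v), (ω a - p a)| * l ≤
      Real.log (2 * Fintype.card ι) + l ^ 2 * N := by
    rw [← abs_of_pos hl0, ← abs_mul, abs_of_pos hl0, abs_le]
    constructor <;> linarith
  rw [← le_div_iff₀ hl0] at h3
  refine h3.trans (le_of_eq ?_)
  field_simp

lemma rounding_error_le {r n : ℕ} (hr : 2 ≤ r) (hn : 24 ^ 6 * (2 * r) ≤ n) :
    Real.log (2 * (r * n)) / (1 / 2 * (n : ℝ) ^ (-(1 / 3) : ℝ)) +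
      1 / 2 * (n : ℝ) ^ (-(1 / 3) : ℝ) * n ^ (r - 1) ≤ (n : ℝ) ^ ((r : ℝ) - 4 / 3) := by
  have hn1 : 1 ≤ n := le_trans (by omega) hn
  have hn1' : (1 : ℝ) ≤ n := by exact_mod_cast hn1
  have hn' : (0 : ℝ) < n := by linarith
  have h1 : (n : ℝ) ^ (-(1 / 3) : ℝ) * n ^ (r - 1) = (n : ℝ) ^ ((r : ℝ) - 4 / 3) := by
    rw [← Real.rpow_natCast, ← Real.rpow_add hn', Nat.cast_sub (by omega)]
    congr 1
    push_cast
    ring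
  have h2 : Real.log (2 * (r * n)) ≤ 1 / 4 * (n : ℝ) ^ (1 / 3 : ℝ) := by
    have h3 := Real.log_le_rpow_div (x := 2 * (r * n)) (ε := 1 / 6) (by positivity) (by norm_num)
    have h4 : 24 * (2 * (r * n) : ℝ) ^ (1 / 6 : ℝ) ≤ (n : ℝ) ^ (1 / 3 : ℝ) := by
      have e1 : (24 : ℝ) = (24 ^ 6) ^ (1 / 6 : ℝ) := by
        rw [← Real.rpow_natCast, ← Real.rpow_mul (by norm_num)]; norm_num
      have e2 : (n : ℝ) ^ (1 / 3 : ℝ) = ((n : ℝ) ^ 2) ^ (1 / 6 : ℝ) := by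
        rw [← Real.rpow_natCast, ← Real.rpow_mul hn'.le]; norm_num
      rw [e1, e2, ← Real.mul_rpow (by positivity) (by positivity)]
      refine Real.rpow_le_rpow (by positivity) ?_ (by norm_num)
      have : (24 ^ 6 * (2 * r) : ℝ) ≤ n := by exact_mod_cast hn
      nlinarith
    linarith
  have h5 : Real.log (2 * (r * n)) / (1 / 2 * (n : ℝ) ^ (-(1 / 3) : ℝ)) ≤
      1 / 2 * (n : ℝ) ^ (2 / 3 : ℝ) := by
    rw [div_le_iff₀ (by positivity)]
    refine h2.trans (le_of_eq ?_)
    have : (n : ℝ) ^ (1 / 3 : ℝ) = (n : ℝ) ^ (2 / 3 : ℝ) * (n : ℝ) ^ (-(1 / 3) : ℝ) := by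
      rw [← Real.rpow_add hn']; norm_num
    rw [this]; ring
  have h6 : (n : ℝ) ^ (2 / 3 : ℝ) ≤ (n : ℝ) ^ ((r : ℝ) - 4 / 3) := by
    refine Real.rpow_le_rpow_of_exponent_le hn1' ?_
    have : (2 : ℝ) ≤ r := by exact_mod_cast hr
    linarith
  rw [mul_assoc, h1]
  linarith

lemma exists_zero_one_weight (r : ℕ) (hr : 2 ≤ r) (d : ℝ) (hd : 0 < d) (hd1 : d ≤ 1) :
    ∃ ε₀ : ℝ, 0 < ε₀ ∧ ∃ n₀ : ℕ, ∀ ε : ℝ, 0 < ε → ε ≤ ε₀ → ∀ n : ℕ, n₀ ≤ n → 0 < n ∧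
    ∀ (a : Fin r → Fin r → Fin n → Fin n → ℝ) (D : Fin r → Fin r → ℝ),
    IsQuasirandom a D d ε →
    ∃ ω : (Fin r → Fin n) → ℝ, (∀ t, ω t = 0 ∨ ω t = 1) ∧
      ∀ i u, |∑ t ∈ (univ.filter fun t => cliqueInd a t = 1).filter (fun t => t i = u), ω t -
        1 / 2 * (n : ℝ) ^ (r - 1) * ∏ p ∈ ltPairs r, D p.1 p.2| ≤
          (n : ℝ) ^ ((r : ℝ) - 4 / 3) := by
  obtain ⟨ε₀, hε₀, hfrac⟩ := exists_fractional_weight r (by omega) d hd hd1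
  refine ⟨ε₀, hε₀, 24 ^ 6 * (2 * r), fun ε hε hεε n hn => ?_⟩
  have hn0 : 0 < n := lt_of_lt_of_le (by omega) hn
  refine ⟨hn0, fun a D H => ?_⟩
  have hn' : (0 : ℝ) < n := by exact_mod_cast hn0
  obtain ⟨x, hx0, hxc, hx⟩ := hfrac ε hε hεε n hn0 a D H
  have hpow : (n : ℝ) ^ r = n * n ^ (r - 1) := by
    rw [← pow_succ', Nat.sub_add_cancel (by omega)]
  have hfib : ∀ (i : Fin r) (u : Fin n) (w : (Fin r → Fin n) → ℝ),
      n * ∑ t ∈ univ.filter (fun t : Fin r → Fin n => t i = u), w t =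
        ∑ t, w (Function.update t i u) := by
    intro i u w
    have h := card_mul_sum_mul_apply i w fun y => if y = u then 1 else 0
    simpa [sum_filter] using h
  have hcardfib : ∀ (i : Fin r) (u : Fin n),
      (#(univ.filter (fun t : Fin r → Fin n => t i = u)) : ℝ) = n ^ (r - 1) := by
    intro i u
    refine mul_left_cancel₀ hn'.ne' ?_
    have := hfib i u fun _ => 1
    simp only [sum_const, nsmul_eq_mul, mul_one, card_univ, Fintype.card_pi, Fintype.card_fin,
      prod_const, Nat.cast_pow] at this
    rw [this, hpow]
  set S := univ.filter fun t => cliqueInd a t = 1 with hS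
  have : Nonempty (Fin r × Fin n) := ⟨(⟨0, by omega⟩, ⟨0, hn0⟩)⟩
  have hl1 : 1 / 2 * (n : ℝ) ^ (-(1 / 3) : ℝ) ≤ 1 := by
    have : (n : ℝ) ^ (-(1 / 3) : ℝ) ≤ 1 :=
      Real.rpow_le_one_of_one_le_of_nonpos (by exact_mod_cast hn0) (by norm_num)
    linarith
  obtain ⟨ω, hω, hdisc⟩ := exists_rounding_abs x hx0
    (fun t => (hxc t).trans (H.cliqueInd_le_one t)) (fun (q : Fin r × Fin n) t => t q.1 = q.2) S
    (l := 1 / 2 * (n : ℝ) ^ (-(1 / 3) : ℝ)) (N := (n : ℝ) ^ (r - 1)) (by positivity) hl1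
    (fun q => by
      rw [← hcardfib q.1 q.2]
      exact_mod_cast card_le_card (filter_subset_filter _ (subset_univ _)))
  refine ⟨ω, hω, fun i u => ?_⟩
  have h1 := hdisc (i, u)
  have h2 : ∑ t ∈ S.filter (fun t => t i = u), x t =
      1 / 2 * (n : ℝ) ^ (r - 1) * ∏ p ∈ ltPairs r, D p.1 p.2 := by
    have h3 : ∑ t ∈ S.filter (fun t => t i = u), x t =
        ∑ t ∈ univ.filter (fun t : Fin r → Fin n => t i = u), x t := by
      refine sum_subset (filter_subset_filter _ (subset_univ _)) fun t ht hnt => ?_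
      have h4 : cliqueInd a t ≠ 1 := fun h => hnt (by
        simp only [hS, mem_filter, mem_univ, true_and] at ht ⊢
        exact ⟨h, ht⟩)
      have h5 := (H.cliqueInd_zero_one t).resolve_right h4
      exact le_antisymm (h5 ▸ hxc t) (hx0 t)
    rw [h3]
    refine mul_left_cancel₀ hn'.ne' ?_
    rw [hfib, hx, hpow]
    ring
  rw [sum_sub_distrib, h2] at h1
  refine h1.trans (le_trans (le_of_eq ?_) (rounding_error_le hr hn))
  simp

/-- The adjacency indicators of a partite graph whose `i`-th part is enumerated by `e i`. -/
noncomputable def adjInd {V : Type*} (G : SimpleGraph V) [DecidableRel G.Adj] {r n : ℕ}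
    (e : Fin r → Fin n → V) (i j : Fin r) (x y : Fin n) : ℝ :=
  if G.Adj (e i x) (e j y) then 1 else 0

lemma nbrCount_eq_sum {V : Type*} [Fintype V] [DecidableEq V] (G : SimpleGraph V)
    [DecidableRel G.Adj] (v : V) (B : Finset V) :
    (nbrCount G v B : ℝ) = ∑ w ∈ B, if G.Adj v w then (1 : ℝ) else 0 := by
  simp [nbrCount]

lemma nbrCount_image {V : Type*} [Fintype V] [DecidableEq V] (G : SimpleGraph V)
    [DecidableRel G.Adj] {r n : ℕ} (e : Fin r → Fin n → V)
    (he : ∀ i, Function.Injective (e i)) (i j : Fin r) (x : Fin n) (Y : Finset (Fin n)) :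
    (nbrCount G (e i x) (Y.image (e j)) : ℝ) = ∑ y ∈ Y, adjInd G e i j x y := by
  rw [nbrCount_eq_sum, sum_image (he j).injOn]
  rfl

lemma pairDensity_mul_card {V : Type*} [Fintype V] [DecidableEq V] (G : SimpleGraph V)
    [DecidableRel G.Adj] (A B : Finset V) :
    pairDensity G A B * (A.card * B.card) = ∑ v ∈ A, (nbrCount G v B : ℝ) := by
  unfold pairDensity
  rcases A.eq_empty_or_nonempty with rfl | hA
  · simp
  rcases B.eq_empty_or_nonempty with rfl | hB
  · simp [nbrCount]
  have := hA.card_pos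
  have := hB.card_pos
  field_simp

lemma pairDensity_le_one {V : Type*} [Fintype V] [DecidableEq V] (G : SimpleGraph V)
    [DecidableRel G.Adj] (A B : Finset V) : pairDensity G A B ≤ 1 := by
  unfold pairDensity
  refine div_le_one_of_le₀ ?_ (by positivity)
  calc ∑ v ∈ A, (nbrCount G v B : ℝ) ≤ ∑ v ∈ A, (B.card : ℝ) :=
        sum_le_sum fun v _ => by exact_mod_cast card_filter_le _ _
    _ = A.card * B.card := by simp

lemma pairDensity_comm {V : Type*} [Fintype V] [DecidableEq V] (G : SimpleGraph V)
    [DecidableRel G.Adj] (A B : Finset V) : pairDensity G A B = pairDensity G B A := by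
  unfold pairDensity
  congr 1
  · simp only [nbrCount_eq_sum]
    rw [sum_comm]
    simp only [G.adj_comm]
  · ring

lemma isQuasirandom_adjInd {V : Type*} [Fintype V] [DecidableEq V] (G : SimpleGraph V)
    [DecidableRel G.Adj] {r n : ℕ} (A : Fin r → Finset V) (e : Fin r → Fin n → V)
    (he : ∀ i, Function.Injective (e i)) (hA : ∀ i, univ.image (e i) = A i)
    (D : Fin r → Fin r → ℝ) (d ε : ℝ) (hd : 0 < d) (hε : 0 < ε)
    (h : ∀ i j, i ≠ j → d ≤ D i j ∧ IsSuperRegular G (A i) (A j) (D i j) ε) :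
    IsQuasirandom (adjInd G e) D d ε := by
  have hcard : ∀ i, (A i).card = n := fun i => by
    rw [← hA, card_image_of_injective _ (he i)]; simp
  have hD1 : ∀ i j, i ≠ j → D i j ≤ 1 := fun i j hij => by
    rw [← (h i j hij).2.1.1]; exact pairDensity_le_one _ _ _
  have h01 : ∀ i j x y, adjInd G e i j x y = 0 ∨ adjInd G e i j x y = 1 := fun i j x y => by
    unfold adjInd; split_ifs <;> simp
  refine ⟨h01, fun i j x y => ?_, fun i j => ?_, fun i j hij => (h i j hij).1, hD1,
    fun i j hij X Y => ?_, fun i j hij x => ?_⟩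
  · simp only [adjInd, G.adj_comm]
  · by_cases hij : i = j
    · rw [hij]
    · rw [← (h i j hij).2.1.1, ← (h j i (Ne.symm hij)).2.1.1, pairDensity_comm]
  · have hX : ((X.image (e i)).card : ℝ) = X.card := by
      rw [card_image_of_injective _ (he i)]
    have hY : ((Y.image (e j)).card : ℝ) = Y.card := by
      rw [card_image_of_injective _ (he j)]
    have hXn : (X.card : ℝ) ≤ n := by exact_mod_cast (card_le_univ X).trans (by simp)
    have hYn : (Y.card : ℝ) ≤ n := by exact_mod_cast (card_le_univ Y).trans (by simp)
    by_cases hbig : ε * n ≤ X.card ∧ ε * n ≤ Y.card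
    · have hreg := (h i j hij).2.1.2 (X.image (e i))
        (by rw [← hA]; exact image_subset_image (subset_univ _)) (Y.image (e j))
        (by rw [← hA]; exact image_subset_image (subset_univ _))
        (by rw [hX, hcard]; exact hbig.1) (by rw [hY, hcard]; exact hbig.2)
      have hpd := pairDensity_mul_card G (X.image (e i)) (Y.image (e j))
      rw [sum_image (he i).injOn, hX, hY] at hpd
      simp only [nbrCount_image G e he] at hpd
      have hs : ∑ x ∈ X, ∑ y ∈ Y, (adjInd G e i j x y - D i j) =
          (pairDensity G (X.image (e i)) (Y.image (e j)) - D i j) * (X.card * Y.card) := by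
        rw [sub_mul, hpd]
        simp only [sum_sub_distrib, sum_const, nsmul_eq_mul]
        ring
      rw [hs, abs_mul, abs_of_nonneg (by positivity : (0 : ℝ) ≤ X.card * Y.card), sq]
      gcongr
    · have hs : |∑ x ∈ X, ∑ y ∈ Y, (adjInd G e i j x y - D i j)| ≤ X.card * Y.card := by
        refine (abs_sum_le_sum_abs _ _).trans ?_
        calc ∑ x ∈ X, |∑ y ∈ Y, (adjInd G e i j x y - D i j)|
            ≤ ∑ x ∈ X, ∑ y ∈ Y, (1 : ℝ) := by
              refine sum_le_sum fun x _ => (abs_sum_le_sum_abs _ _).trans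
                (sum_le_sum fun y _ => ?_)
              have := hD1 i j hij
              have := (h i j hij).1
              rw [abs_le]
              rcases h01 i j x y with h0 | h0 <;> rw [h0] <;> constructor <;> linarith
          _ = X.card * Y.card := by simp
      refine hs.trans ?_
      rw [sq, ← mul_assoc]
      rcases not_and_or.mp hbig with hb | hb
      · exact mul_le_mul (not_le.mp hb).le hYn (by positivity) (by positivity)
      · calc (X.card : ℝ) * Y.card ≤ n * (ε * n) :=
              mul_le_mul hXn (not_le.mp hb).le (by positivity) (by positivity)
          _ = ε * n * n := by ring
  · have hv : e i x ∈ A i := by rw [← hA]; exact mem_image_of_mem _ (mem_univ _)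
    have := (h i j hij).2.2.1 _ hv
    rw [hcard, ← hA j, nbrCount_image G e he] at this
    exact this

lemma cliqueInd_adjInd_eq_one {V : Type*} (G : SimpleGraph V)
    [DecidableRel G.Adj] {r n : ℕ} (e : Fin r → Fin n → V) (t : Fin r → Fin n) :
    cliqueInd (adjInd G e) t = 1 ↔ ∀ i j, i ≠ j → G.Adj (e i (t i)) (e j (t j)) := by
  have h1 : cliqueInd (adjInd G e) t = 1 ↔
      ∀ p ∈ ltPairs r, G.Adj (e p.1 (t p.1)) (e p.2 (t p.2)) := by
    unfold cliqueInd adjInd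
    rw [prod_boole]
    split_ifs with h
    · exact iff_of_true rfl h
    · exact iff_of_false zero_ne_one h
  rw [h1]
  constructor
  · intro h i j hij
    rcases lt_or_gt_of_ne hij with hl | hl
    · exact h (i, j) (by simp [ltPairs, hl])
    · exact (h (j, i) (by simp [ltPairs, hl])).symm
  · intro h
    exact fun p hp => h _ _ (mem_filter.mp hp).2.ne

/-- The vertex set of the transversal of the enumerated parts with coordinates `t`. -/
def transversal {V : Type*} [DecidableEq V] {r n : ℕ} (e : Fin r → Fin n → V)
    (t : Fin r → Fin n) : Finset V :=
  univ.image fun i => e i (t i)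

section Transversal

variable {W : Type*} [DecidableEq W] {r n : ℕ} {e : Fin r → Fin n → W}

lemma apply_mem_transversal (he : ∀ i j x y, e i x = e j y → i = j ∧ x = y)
    (t : Fin r → Fin n) (i : Fin r) (x : Fin n) : e i x ∈ transversal e t ↔ t i = x := by
  simp only [transversal, mem_image, mem_univ, true_and]
  constructor
  · rintro ⟨j, hj⟩
    obtain ⟨rfl, hx⟩ := he _ _ _ _ hj
    exact hx
  · rintro rfl
    exact ⟨i, rfl⟩

lemma transversal_injective (he : ∀ i j x y, e i x = e j y → i = j ∧ x = y) :
    Function.Injective (transversal e) := by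
  intro s t hst
  funext i
  have := (apply_mem_transversal he s i (s i)).mpr rfl
  rw [hst, apply_mem_transversal he] at this
  exact this.symm

lemma transvCliques_eq_image [Fintype W] (G : SimpleGraph W) [DecidableRel G.Adj]
    (he : ∀ i j x y, e i x = e j y → i = j ∧ x = y) (hsurj : ∀ v, ∃ i x, e i x = v)
    (A : Fin r → Finset W) (hA : ∀ i, univ.image (e i) = A i) :
    transvCliques G A =
      (univ.filter fun t => cliqueInd (adjInd G e) t = 1).image (transversal e) := by
  have hmem : ∀ i v, v ∈ A i ↔ ∃ x, e i x = v := fun i v => by simp [← hA]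
  ext K
  simp only [transvCliques, mem_filter, mem_univ, true_and, mem_image, cliqueInd_adjInd_eq_one]
  constructor
  · rintro ⟨hK, h1⟩
    have hex : ∀ i, ∃ x, K ∩ A i = {e i x} := fun i => by
      obtain ⟨v, hv⟩ := card_eq_one.mp (h1 i)
      have hvm : v ∈ K ∩ A i := by rw [hv]; exact mem_singleton_self _
      obtain ⟨x, rfl⟩ := (hmem i v).mp (mem_inter.mp hvm).2
      exact ⟨x, hv⟩
    choose t ht using hex
    have htK : ∀ i, e i (t i) ∈ K := fun i => by
      have : e i (t i) ∈ K ∩ A i := by rw [ht]; exact mem_singleton_self _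
      exact (mem_inter.mp this).1
    refine ⟨t, fun i j hij => hK (htK i) (htK j) fun h => hij (he _ _ _ _ h).1, ?_⟩
    ext v
    obtain ⟨i, x, rfl⟩ := hsurj v
    rw [apply_mem_transversal he]
    constructor
    · rintro rfl
      exact htK i
    · intro hx
      have : e i x ∈ K ∩ A i := mem_inter.mpr ⟨hx, (hmem _ _).mpr ⟨x, rfl⟩⟩
      rw [ht, mem_singleton] at this
      exact ((he _ _ _ _ this).2).symm
  · rintro ⟨t, ht, rfl⟩
    refine ⟨?_, fun i => card_eq_one.mpr ⟨e i (t i), ?_⟩⟩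
    · intro v hv w hw hvw
      simp only [transversal, coe_image, coe_univ, Set.image_univ, Set.mem_range] at hv hw
      obtain ⟨i, rfl⟩ := hv
      obtain ⟨j, rfl⟩ := hw
      exact ht i j fun h => hvw (by rw [h])
    · ext v
      rw [mem_inter, mem_singleton, hmem]
      constructor
      · rintro ⟨hv, x, rfl⟩
        rw [(apply_mem_transversal he t i x).mp hv]
      · rintro rfl
        exact ⟨(apply_mem_transversal he t i _).mpr rfl, t i, rfl⟩

end Transversal

/-- Rounded fractional matching: in an `r`-partite system of `(d_{i,j},ε)`-super-regular pairs
with `d_{i,j} ≥ d`, the hypergraph `𝓗` of `r`-partite cliques admits a `{0,1}`-weighting `ω`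
with `|∑_{H ∋ v} ω(H) - ½ n^{r-1} ∏_{i<j} d_{i,j}| ≤ n^{r-4/3}` for every vertex `v`. -/
theorem statement14 :
    ∀ r : ℕ, 2 ≤ r → ∀ d : ℝ, 0 < d → d ≤ 2 / 3 →
    ∃ ε₀ : ℝ, 0 < ε₀ ∧ ∃ n₀ : ℕ, ∀ ε : ℝ, 0 < ε → ε ≤ ε₀ → ∀ n : ℕ, n₀ ≤ n →
    ∀ (V : Type) (_ : Fintype V) (_ : DecidableEq V)
      (G : SimpleGraph V) (_ : DecidableRel G.Adj) (A : Fin r → Finset V)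
      (D : Fin r → Fin r → ℝ),
    (∀ i, (A i).card = n) →
    (Finset.univ : Finset V) = Finset.univ.biUnion A →
    (Pairwise fun i j => Disjoint (A i) (A j)) →
    (∀ i, ∀ u ∈ A i, ∀ v ∈ A i, ¬ G.Adj u v) →
    (∀ i j, i ≠ j → d ≤ D i j ∧ IsSuperRegular G (A i) (A j) (D i j) ε) →
    ∃ ω : Finset V → ℝ,
      (∀ K ∈ transvCliques G A, ω K = 0 ∨ ω K = 1) ∧
      ∀ v : V,
        |(∑ K ∈ (transvCliques G A).filter (fun K => v ∈ K), ω K) -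
            (1 / 2) * (n : ℝ) ^ (r - 1) *
              ∏ p ∈ Finset.univ.filter (fun p : Fin r × Fin r => p.1 < p.2), D p.1 p.2| ≤
          (n : ℝ) ^ ((r : ℝ) - 4 / 3) := by
  intro r hr d hd hd1
  obtain ⟨ε₀, hε₀, n₀, h⟩ := exists_zero_one_weight r hr d hd (by linarith)
  refine ⟨ε₀, hε₀, n₀, fun ε hε hεε n hn V _ _ G _ A D hcard huniv hdisj _ hreg => ?_⟩
  set e : Fin r → Fin n → V := fun i x => ((A i).equivFinOfCardEq (hcard i)).symm x with he
  have he_inj : ∀ i, Function.Injective (e i) := fun i x y hxy => by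
    simpa [he, Subtype.ext_iff] using hxy
  have he_mem : ∀ i x, e i x ∈ A i := fun i x => Subtype.coe_prop _
  have heA : ∀ i, univ.image (e i) = A i := fun i => by
    refine eq_of_subset_of_card_le (image_subset_iff.mpr fun x _ => he_mem i x) ?_
    rw [card_image_of_injective _ (he_inj i), hcard]
    simp
  have he2 : ∀ i j x y, e i x = e j y → i = j ∧ x = y := fun i j x y hxy => by
    have hij : i = j := by
      by_contra hij
      exact disjoint_left.mp (hdisj hij) (he_mem i x) (hxy ▸ he_mem j y)
    subst hij
    exact ⟨rfl, he_inj i hxy⟩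
  have hsurj : ∀ v, ∃ i x, e i x = v := fun v => by
    have hv := mem_univ v
    rw [huniv] at hv
    obtain ⟨i, -, hi⟩ := mem_biUnion.mp hv
    rw [← heA] at hi
    obtain ⟨x, -, hx⟩ := mem_image.mp hi
    exact ⟨i, x, hx⟩
  obtain ⟨ω, hω, hsum⟩ := (h ε hε hεε n hn).2 (adjInd G e) D
    (isQuasirandom_adjInd G A e he_inj heA D d ε hd hε hreg)
  have hinj := transversal_injective he2
  have hcliques := transvCliques_eq_image G he2 hsurj A heA
  refine ⟨Function.extend (transversal e) ω 0, fun K hK => ?_, fun v => ?_⟩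
  · rw [hcliques] at hK
    obtain ⟨t, -, rfl⟩ := mem_image.mp hK
    rw [hinj.extend_apply]
    exact hω t
  · obtain ⟨i, u, rfl⟩ := hsurj v
    rw [hcliques, filter_image, sum_image hinj.injOn]
    simp only [hinj.extend_apply, apply_mem_transversal he2]
    exact hsum i u
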